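/- arXiv:math/0701940 — 2 statements merged into one kernel-verified Lean document; each statement's English description precedes it below -/
import Mathlib

section
/- Let (B,W) be a polygonal coloring of the plane with boundary ∂ satisfying condition (C3), and let A be a feasible point lying on the boundary segment s. Then the set ∂ ∩ C(A) consists of exactly six points; moreover, there is a unit vector u such that ∂ ∩ C(A) = {A + ρⁱ(u) : i = 0, 1, …, 5}, where ρ is the rotation of ℝ² by angle π/3 about the origin (so the six points form the vertex set of a regular hexagon inscribed in C(A)), and each of these six points lies on a boundary segment parallel to s. -/
open scoped RealInnerProductSpace

noncomputable section

/-- `l` is an (affine) line in the plane: a nonempty one-dimensional affine subspace. -/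
def IsLine (l : AffineSubspace ℝ (EuclideanSpace ℝ (Fin 2))) : Prop :=
  (l : Set (EuclideanSpace ℝ (Fin 2))).Nonempty ∧ Module.finrank ℝ l.direction = 1

/-- A boundary segment: a closed convex subset of some affine line, containing
more than one point (it may be a segment, a ray, or a full line). -/
def IsSeg (s : Set (EuclideanSpace ℝ (Fin 2))) : Prop :=
  IsClosed s ∧ Convex ℝ s ∧ s.Nontrivial ∧
    ∃ l : AffineSubspace ℝ (EuclideanSpace ℝ (Fin 2)), IsLine l ∧ s ⊆ (l : Set _)

/-- `x` is an endpoint of the segment `s`: a point of `s` not in its relative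
(intrinsic) interior. -/
def IsEndpoint (x : EuclideanSpace ℝ (Fin 2)) (s : Set (EuclideanSpace ℝ (Fin 2))) : Prop :=
  x ∈ s ∧ x ∉ intrinsicInterior ℝ s

/-- The coloring `(B, Bᶜ)` is polygonal, with set of boundary segments `S`. -/
structure IsPolygonal (B : Set (EuclideanSpace ℝ (Fin 2)))
    (S : Set (Set (EuclideanSpace ℝ (Fin 2)))) : Prop where
  /-- The black points lie in the closure of the black interior. -/
  black_sub : B ⊆ closure (interior B)
  /-- The white points lie in the closure of the white interior. -/
  white_sub : Bᶜ ⊆ closure (interior Bᶜ)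
  /-- Every member of `S` is a boundary segment. -/
  seg : ∀ s ∈ S, IsSeg s
  /-- The boundary of the coloring is the union of the boundary segments. -/
  boundary : frontier B = ⋃₀ S
  /-- Two distinct boundary segments meet in at most one point. -/
  inter_subsingleton : ∀ s ∈ S, ∀ t ∈ S, s ≠ t → (s ∩ t).Subsingleton
  /-- A common point of two distinct boundary segments is an endpoint of both. -/
  inter_endpoint : ∀ s ∈ S, ∀ t ∈ S, s ≠ t → ∀ x ∈ s ∩ t, IsEndpoint x s ∧ IsEndpoint x t
  /-- No two distinct boundary segments sharing a common point lie on a common line. -/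
  no_common_line : ∀ s ∈ S, ∀ t ∈ S, s ≠ t → (s ∩ t).Nonempty →
      ¬∃ l : AffineSubspace ℝ (EuclideanSpace ℝ (Fin 2)),
        IsLine l ∧ s ⊆ (l : Set _) ∧ t ⊆ (l : Set _)
  /-- Every bounded region meets only finitely many boundary segments. -/
  loc_finite : ∀ R : Set (EuclideanSpace ℝ (Fin 2)), Bornology.IsBounded R →
      {s ∈ S | (s ∩ R).Nonempty}.Finite

/-- Condition (C3): every monochromatic unit triangle has a vertex on the boundary. -/
def C3 (B : Set (EuclideanSpace ℝ (Fin 2))) : Prop :=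
  ∀ X Y Z : EuclideanSpace ℝ (Fin 2),
    dist X Y = 1 → dist Y Z = 1 → dist Z X = 1 →
    ((X ∈ B ∧ Y ∈ B ∧ Z ∈ B) ∨ (X ∉ B ∧ Y ∉ B ∧ Z ∉ B)) →
    X ∈ frontier B ∨ Y ∈ frontier B ∨ Z ∈ frontier B

/-- `x` is a boundary vertex: an endpoint of some boundary segment. -/
def IsVertex (S : Set (Set (EuclideanSpace ℝ (Fin 2)))) (x : EuclideanSpace ℝ (Fin 2)) : Prop :=
  ∃ s ∈ S, IsEndpoint x s

/-- A boundary point `A` is feasible if it is not a boundary vertex and the unit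
circle centered at `A` contains no boundary vertex. -/
def Feasible (B : Set (EuclideanSpace ℝ (Fin 2))) (S : Set (Set (EuclideanSpace ℝ (Fin 2))))
    (A : EuclideanSpace ℝ (Fin 2)) : Prop :=
  A ∈ frontier B ∧ ¬IsVertex S A ∧ ∀ P ∈ Metric.sphere A 1, ¬IsVertex S P

/-- Two segments are parallel: any lines containing them have the same direction. -/
def SegParallel (s t : Set (EuclideanSpace ℝ (Fin 2))) : Prop :=
  ∀ l₁ l₂ : AffineSubspace ℝ (EuclideanSpace ℝ (Fin 2)),
    IsLine l₁ → IsLine l₂ → s ⊆ (l₁ : Set _) → t ⊆ (l₂ : Set _) →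
    l₁.direction = l₂.direction

end

/-- Rotation of a vector of the plane by angle `θ` counterclockwise about the origin. -/
noncomputable def rotVec (θ : ℝ) (v : EuclideanSpace ℝ (Fin 2)) : EuclideanSpace ℝ (Fin 2) :=
  (WithLp.equiv 2 (Fin 2 → ℝ)).symm
    ![Real.cos θ * v 0 - Real.sin θ * v 1, Real.sin θ * v 0 + Real.cos θ * v 1]

noncomputable section

open Real

open Filter Topology

section Flat

variable {E : Type*} [NormedAddCommGroup E] [InnerProductSpace ℝ E]

/-- Near `p`, the sets `U` and `V` are the two open sides of the hyperplane through `p` with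
normal vector `n`, where `n` points towards `U`. -/
def Flat (U V : Set E) (p n : E) : Prop :=
  ∀ᶠ z in 𝓝 p, (0 < inner ℝ n (z - p) → z ∈ U) ∧ (inner ℝ n (z - p) < 0 → z ∈ V) ∧
    (inner ℝ n (z - p) = 0 → z ∉ U ∧ z ∉ V)

variable {U V : Set E} {p n : E}

theorem Flat.swap (h : Flat U V p n) : Flat V U p (-n) := by
  filter_upwards [h] with z ⟨h1, h2, h3⟩
  simp only [inner_neg_left, neg_eq_zero, Left.neg_pos_iff, Left.neg_neg_iff]
  exact ⟨h2, h1, fun h => (h3 h).symm⟩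

theorem Flat.notMem (h : Flat U V p n) : p ∉ U ∧ p ∉ V :=
  h.self_of_nhds.2.2 (by simp)

theorem Flat.eventually_flat (h : Flat U V p n) :
    ∀ᶠ q in 𝓝 p, inner ℝ n (q - p) = 0 → Flat U V q n := by
  filter_upwards [eventually_eventually_nhds.2 h] with q hq hqn
  filter_upwards [hq] with z hz
  have : inner ℝ n (z - q) = inner ℝ n (z - p) := by
    rw [show z - q = (z - p) - (q - p) by abel, inner_sub_right, hqn, sub_zero]
  rwa [this]

theorem eventually_pos_of_hasDerivAt {f : ℝ → ℝ} {c : ℝ} (h0 : f 0 = 0) (hd : HasDerivAt f c 0)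
    (hc : 0 < c) : ∀ᶠ t in 𝓝[>] 0, 0 < f t := by
  have h1 := (hasDerivAt_iff_tendsto_slope.1 hd).eventually_const_lt hc
  have h2 : ∀ᶠ t in 𝓝[>] (0 : ℝ), 0 < slope f 0 t :=
    h1.filter_mono (nhdsWithin_mono _ fun t ht => ne_of_gt ht)
  filter_upwards [h2, self_mem_nhdsWithin] with t ht ht0
  rw [slope_def_field, h0, sub_zero, sub_zero] at ht
  exact (div_pos_iff_of_pos_right ht0).1 ht

theorem Flat.eventually_mem_of_hasDerivAt (h : Flat U V p n) {γ : ℝ → E} {γ' : E} (h0 : γ 0 = p)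
    (hd : HasDerivAt γ γ' 0) (hp : 0 < inner ℝ n γ') : ∀ᶠ t in 𝓝[>] 0, γ t ∈ U := by
  have h1 : HasDerivAt (fun t => inner ℝ n (γ t - p)) (inner ℝ n γ') 0 := by
    simpa using (hasDerivAt_const (0 : ℝ) n).inner ℝ (hd.sub_const p)
  have h2 : Tendsto γ (𝓝[>] 0) (𝓝 p) := by
    have := hd.continuousAt.tendsto
    rw [h0] at this
    exact this.mono_left nhdsWithin_le_nhds
  filter_upwards [eventually_pos_of_hasDerivAt (by simp [h0]) h1 hp, h2.eventually h] with t ht ht'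
  exact ht'.1 ht

/-- A point moving from `p` with velocity `w` immediately enters `U`. -/
def Enters (U V : Set E) (p w : E) : Prop :=
  p ∈ U ∨ ∃ n, Flat U V p n ∧ 0 < inner ℝ n w

theorem Enters.eventually_mem {w : E} (h : Enters U V p w) (hU : IsOpen U) {γ : ℝ → E}
    (h0 : γ 0 = p) (hd : HasDerivAt γ w 0) : ∀ᶠ t in 𝓝[>] 0, γ t ∈ U := by
  rcases h with h | ⟨n, hn, hw⟩
  · refine (hd.continuousAt.eventually ?_).filter_mono nhdsWithin_le_nhds
    rw [h0]
    exact hU.mem_nhds h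
  · exact hn.eventually_mem_of_hasDerivAt h0 hd hw

end Flat

/-- `U` and `V` are disjoint open sets and `η` is a primitive sixth root of unity such that neither
set contains the vertices of a unit triangle `z, z + u, z + η u`. -/
structure TriangleFree (U V : Set ℂ) (η : ℂ) : Prop where
  isOpen_left : IsOpen U
  isOpen_right : IsOpen V
  disjoint : Disjoint U V
  norm_eq : ‖η‖ = 1
  re_eq : η.re = 1 / 2
  left : ∀ z u : ℂ, ‖u‖ = 1 → z ∈ U → z + u ∈ U → z + η * u ∈ U → False
  right : ∀ z u : ℂ, ‖u‖ = 1 → z ∈ V → z + u ∈ V → z + η * u ∈ V → False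

theorem inner_eq_re_im (n z : ℂ) : inner ℝ n z = n.re * z.re + n.im * z.im := by
  rw [Complex.inner]; simp; ring

theorem hasDerivAt_rotation (p : ℂ) (k : ℝ) :
    HasDerivAt (fun t : ℝ => p * Complex.exp (((k * t : ℝ) : ℂ) * Complex.I))
      (k * (Complex.I * p)) 0 := by
  have h1 : HasDerivAt (fun t : ℝ => ((k * t : ℝ) : ℂ)) k 0 := by
    simpa using ((hasDerivAt_id (0 : ℝ)).const_mul k).ofReal_comp
  have h2 := ((h1.mul_const Complex.I).cexp).const_mul p
  refine h2.congr_deriv ?_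
  simp; ring

namespace TriangleFree

variable {U V : Set ℂ} {η : ℂ}

theorem swap (h : TriangleFree U V η) : TriangleFree V U η :=
  ⟨h.isOpen_right, h.isOpen_left, h.disjoint.symm, h.norm_eq, h.re_eq, h.right, h.left⟩

theorem ne_zero (h : TriangleFree U V η) : η ≠ 0 := by
  rw [← norm_ne_zero_iff, h.norm_eq]; exact one_ne_zero

theorem inv (h : TriangleFree U V η) : TriangleFree U V η⁻¹ := by
  have hη := h.ne_zero
  refine ⟨h.isOpen_left, h.isOpen_right, h.disjoint, by simp [h.norm_eq],
    by simp [Complex.inv_re, Complex.normSq_eq_norm_sq, h.norm_eq, h.re_eq], ?_, ?_⟩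
  · intro z u hu h1 h2 h3
    exact h.left z (η⁻¹ * u) (by simp [h.norm_eq, hu]) h1 h3 (by rwa [mul_inv_cancel_left₀ hη])
  · intro z u hu h1 h2 h3
    exact h.right z (η⁻¹ * u) (by simp [h.norm_eq, hu]) h1 h3 (by rwa [mul_inv_cancel_left₀ hη])

/-- No infinitesimal rigid motion moves the three vertices of a unit triangle into `U`. -/
theorem not_enters (h : TriangleFree U V η) {a u v : ℂ} {k : ℝ} (hu : ‖u‖ = 1)
    (h1 : Enters U V a v) (h2 : Enters U V (a + u) (v + k * (Complex.I * u)))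
    (h3 : Enters U V (a + η * u) (v + k * (Complex.I * (η * u)))) : False := by
  have ha : HasDerivAt (fun t : ℝ => a + t * v) v 0 := by
    simpa using ((hasDerivAt_id (0 : ℝ)).ofReal_comp.mul_const v).const_add a
  have e1 := h1.eventually_mem h.isOpen_left (by simp) ha
  have e2 := h2.eventually_mem h.isOpen_left (by simp) (ha.add (hasDerivAt_rotation u k))
  have e3 := h3.eventually_mem h.isOpen_left (by simp) (ha.add (hasDerivAt_rotation (η * u) k))
  obtain ⟨t, ht1, ht2, ht3⟩ := (e1.and (e2.and e3)).exists
  refine h.left _ (u * Complex.exp (((k * t : ℝ) : ℂ) * Complex.I)) ?_ ht1 ht2 ?_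
  · rw [norm_mul, hu, Complex.norm_exp_ofReal_mul_I, one_mul]
  · rw [← mul_assoc]; exact ht3

theorem not_mem_and_mem (h : TriangleFree U V η) {a m u : ℂ} (hm : m ≠ 0) (ha : Flat U V a m)
    (hu : ‖u‖ = 1) : ¬ (a + u ∈ U ∧ a + η * u ∈ U) := fun ⟨h1, h2⟩ =>
  h.not_enters (v := m) (k := 0) hu (.inr ⟨m, ha, real_inner_self_pos.2 hm⟩) (.inl h1) (.inl h2)

theorem notMem_left_of_transversal (h : TriangleFree U V η) {a m u n : ℂ} (hm : m ≠ 0)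
    (ha : Flat U V a m) (hu : ‖u‖ = 1) (hn : Flat U V (a + u) n)
    (htr : inner ℝ n (Complex.I * u) ≠ 0) : a + η * u ∉ U := fun hU => by
  refine h.not_enters (v := m) (k := (1 - inner ℝ n m) / inner ℝ n (Complex.I * u)) hu
    (.inr ⟨m, ha, real_inner_self_pos.2 hm⟩) (.inr ⟨n, hn, ?_⟩) (.inl hU)
  rw [inner_add_right, ← Complex.real_smul, inner_smul_right, div_mul_cancel₀ _ htr]
  simp

theorem notMem_of_transversal (h : TriangleFree U V η) {a m u n : ℂ} (hm : m ≠ 0)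
    (ha : Flat U V a m) (hu : ‖u‖ = 1) (hn : Flat U V (a + u) n)
    (htr : inner ℝ n (Complex.I * u) ≠ 0) : a + η * u ∉ U ∧ a + η * u ∉ V :=
  ⟨h.notMem_left_of_transversal hm ha hu hn htr,
    h.swap.notMem_left_of_transversal (neg_ne_zero.2 hm) ha.swap hu hn.swap
      (by rwa [inner_neg_left, neg_ne_zero])⟩

/-- The point `p` rotating about the origin, while the origin moves more slowly in the direction
`m`, immediately enters `U`. -/
def Sweeps (U : Set ℂ) (m p : ℂ) (k : ℝ) : Prop :=
  ∀ᶠ t : ℝ in 𝓝[>] 0, t ^ 3 * m + p * Complex.exp (((k * t : ℝ) : ℂ) * Complex.I) ∈ U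

theorem not_sweeps (h : TriangleFree U V η) {m u : ℂ} {k : ℝ} (hm : m ≠ 0) (h0 : Flat U V 0 m)
    (hu : ‖u‖ = 1) (h1 : Sweeps U m u k) (h2 : Sweeps U m (η * u) k) : False := by
  have hd : HasDerivAt (fun t : ℝ => t * m) m 0 := by
    simpa using (hasDerivAt_id (0 : ℝ)).ofReal_comp.mul_const m
  have e0 := h0.eventually_mem_of_hasDerivAt (by simp) hd (real_inner_self_pos.2 hm)
  have hcube : Tendsto (fun t : ℝ => t ^ 3) (𝓝[>] 0) (𝓝[>] 0) := by
    refine tendsto_nhdsWithin_iff.2 ⟨?_, ?_⟩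
    · have : Tendsto (fun t : ℝ => t ^ 3) (𝓝 0) (𝓝 0) := by
        simpa using (continuous_pow 3 : Continuous fun t : ℝ => t ^ 3).tendsto 0
      exact this.mono_left nhdsWithin_le_nhds
    · filter_upwards [self_mem_nhdsWithin] with t ht
      exact pow_pos (Set.mem_Ioi.1 ht) 3
  obtain ⟨t, ht0, ht1, ht2⟩ := ((hcube.eventually e0).and (h1.and h2)).exists
  refine h.left _ (u * Complex.exp (((k * t : ℝ) : ℂ) * Complex.I)) ?_ ht0 ?_ ?_
  · rw [norm_mul, hu, Complex.norm_exp_ofReal_mul_I, one_mul]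
  · push_cast at ht1 ⊢; exact ht1
  · rw [← mul_assoc]; push_cast at ht2 ⊢; exact ht2

theorem sweeps_of_transversal {m p n : ℂ} {k : ℝ} (hn : Flat U V p n)
    (hk : 0 < k * inner ℝ n (Complex.I * p)) : Sweeps U m p k := by
  have hd : HasDerivAt (fun t : ℝ => (t : ℂ) ^ 3 * m) 0 0 := by
    simpa using (((hasDerivAt_id (0 : ℝ)).ofReal_comp).pow 3).mul_const m
  refine hn.eventually_mem_of_hasDerivAt (by simp) (hd.add (hasDerivAt_rotation p k)) ?_
  rwa [zero_add, ← Complex.real_smul, inner_smul_right]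

theorem sq_add_sq_of_norm {z : ℂ} (hz : ‖z‖ = 1) : z.re ^ 2 + z.im ^ 2 = 1 := by
  have := Complex.sq_norm z
  rw [hz, Complex.normSq_apply] at this
  linarith

theorem sweeps_of_tangential {m p : ℂ} {k : ℝ} (hm : ‖m‖ = 1) (hp : ‖p‖ = 1) (hk : k ^ 2 = 1)
    (hn : Flat U V p (-p)) : Sweeps U m p k := by
  have hc : Continuous fun t : ℝ =>
      (t : ℂ) ^ 3 * m + p * Complex.exp (((k * t : ℝ) : ℂ) * Complex.I) := by fun_prop
  have ht : Tendsto (fun t : ℝ =>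
      (t : ℂ) ^ 3 * m + p * Complex.exp (((k * t : ℝ) : ℂ) * Complex.I)) (𝓝[>] 0) (𝓝 p) := by
    have := hc.tendsto 0
    simp only [Complex.ofReal_zero, mul_zero, zero_mul, Complex.exp_zero, mul_one, ne_eq,
      OfNat.ofNat_ne_zero, not_false_eq_true, zero_pow, zero_add] at this
    exact this.mono_left nhdsWithin_le_nhds
  have hsmall : ∀ᶠ t : ℝ in 𝓝[>] 0, t < min 1 (2 / π ^ 2) :=
    (eventually_lt_nhds (by positivity)).filter_mono nhdsWithin_le_nhds
  filter_upwards [ht.eventually hn, hsmall, self_mem_nhdsWithin] with t h1 h2 h3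
  refine h1.1 ?_
  have h3 : 0 < t := h3
  obtain ⟨h4, h5⟩ := lt_min_iff.1 h2
  have hcos : Real.cos (k * t) ≤ 1 - 2 / π ^ 2 * t ^ 2 := by
    have hkt : |k * t| ≤ π := by
      have : |k| = 1 := by rwa [← sq_eq_sq₀ (abs_nonneg k) zero_le_one, sq_abs, one_pow]
      rw [abs_mul, this, one_mul, abs_of_pos h3]
      linarith [Real.pi_gt_three]
    have := Real.cos_le_one_sub_mul_cos_sq hkt
    rwa [mul_pow, hk, one_mul] at this
  have hpm : inner ℝ p m ≤ 1 := by
    have := real_inner_le_norm p m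
    rwa [hp, hm, one_mul] at this
  have hpp := sq_add_sq_of_norm hp
  have key : inner ℝ (-p) ((t : ℂ) ^ 3 * m + p * Complex.exp (((k * t : ℝ) : ℂ) * Complex.I) - p)
      = 1 - Real.cos (k * t) - t ^ 3 * inner ℝ p m := by
    have h6 : (t : ℂ) ^ 3 * m = (t ^ 3 : ℝ) • m := by rw [Complex.real_smul]; push_cast; rfl
    rw [h6, add_sub_assoc, inner_add_right, inner_smul_right, inner_neg_left]
    simp only [inner_eq_re_im, Complex.sub_re, Complex.sub_im, Complex.mul_re, Complex.mul_im,
      Complex.exp_ofReal_mul_I_re, Complex.exp_ofReal_mul_I_im, Complex.neg_re, Complex.neg_im]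
    linear_combination (1 - Real.cos (k * t)) * hpp
  rw [key]
  have h7 : t ^ 3 * inner ℝ p m ≤ t ^ 3 := mul_le_of_le_one_right (by positivity) hpm
  have h8 : t ^ 3 < 2 / π ^ 2 * t ^ 2 := by
    have : 0 < t ^ 2 * (2 / π ^ 2 - t) := mul_pos (by positivity) (by linarith)
    linarith
  linarith

theorem eq_or_eq_neg_of_tangential {n p : ℂ} (hn : ‖n‖ = 1) (hp : ‖p‖ = 1)
    (h : inner ℝ n (Complex.I * p) = 0) : n = p ∨ n = -p := by
  have h1 := sq_add_sq_of_norm hn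
  have h2 := sq_add_sq_of_norm hp
  simp only [inner_eq_re_im, Complex.mul_re, Complex.mul_im, Complex.I_re, Complex.I_im] at h
  have h3 : (n.re * p.re + n.im * p.im) ^ 2 = 1 := by
    linear_combination (-(n.im * p.re) + n.re * p.im) * h + h1 * (p.re ^ 2 + p.im ^ 2) + h2
  have h4 : n.re = (n.re * p.re + n.im * p.im) * p.re := by
    linear_combination -n.re * h2 - p.im * h
  have h5 : n.im = (n.re * p.re + n.im * p.im) * p.im := by
    linear_combination -n.im * h2 + p.re * h
  rcases sq_eq_one_iff.1 h3 with h6 | h6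
  · rw [h6] at h4 h5
    exact .inl (Complex.ext (by simpa using h4) (by simpa using h5))
  · rw [h6] at h4 h5
    exact .inr (Complex.ext (by simpa using h4) (by simpa using h5))

theorem not_flat_inner_of_transversal (h : TriangleFree U V η) {m u n : ℂ} (hm : ‖m‖ = 1)
    (h0 : Flat U V 0 m) (hu : ‖u‖ = 1) (hn : Flat U V u n)
    (htr : inner ℝ n (Complex.I * u) ≠ 0) : ¬ Flat U V (η * u) (-(η * u)) := fun hn' => by
  have hm0 : m ≠ 0 := norm_ne_zero_iff.1 (by rw [hm]; exact one_ne_zero)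
  have hη : ‖η * u‖ = 1 := by rw [norm_mul, h.norm_eq, hu, one_mul]
  rcases htr.lt_or_gt with hlt | hgt
  · exact h.not_sweeps (k := -1) hm0 h0 hu (sweeps_of_transversal hn (by linarith))
      (sweeps_of_tangential hm hη (by norm_num) hn')
  · exact h.not_sweeps (k := 1) hm0 h0 hu (sweeps_of_transversal hn (by linarith))
      (sweeps_of_tangential hm hη (by norm_num) hn')

/-- Transversality at one point of the circle propagates to its rotation by `η`. -/
theorem transversal_rotate (h : TriangleFree U V η) {m u n n' : ℂ} (hm : ‖m‖ = 1)
    (h0 : Flat U V 0 m) (hu : ‖u‖ = 1) (hn : Flat U V u n)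
    (htr : inner ℝ n (Complex.I * u) ≠ 0) (hn1 : ‖n'‖ = 1) (hn' : Flat U V (η * u) n') :
    inner ℝ n' (Complex.I * (η * u)) ≠ 0 := fun h1 => by
  have hη : ‖η * u‖ = 1 := by rw [norm_mul, h.norm_eq, hu, one_mul]
  rcases eq_or_eq_neg_of_tangential hn1 hη h1 with rfl | rfl
  · exact h.swap.not_flat_inner_of_transversal (by rwa [norm_neg]) h0.swap hu hn.swap
      (by rwa [inner_neg_left, neg_ne_zero]) hn'.swap
  · exact h.not_flat_inner_of_transversal hm h0 hu hn htr hn'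

theorem neg_one_lt_inner {m n : ℂ} (hm : ‖m‖ = 1) (hn : ‖n‖ = 1) (hne : n ≠ -m) :
    -1 < inner ℝ m n := by
  refine lt_of_le_of_ne ?_ fun h1 => hne ?_
  · have := neg_le_of_abs_le (abs_real_inner_le_norm m n)
    rwa [hm, hn, one_mul] at this
  · rw [← add_eq_zero_iff_eq_neg, ← norm_eq_zero, ← sq_eq_zero_iff, norm_add_sq_real,
      real_inner_comm, ← h1, hm, hn]
    norm_num

theorem notMem_of_tangential (h : TriangleFree U V η) {m u n : ℂ} (hm : ‖m‖ = 1)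
    (h0 : Flat U V 0 m) (hu : ‖u‖ = 1) (hn1 : ‖n‖ = 1) (hn : Flat U V u n) (hne : n ≠ -m) :
    η * u ∉ U := fun hU => by
  have h1 := neg_one_lt_inner hm hn1 hne
  refine h.not_enters (a := 0) (v := m + n) (k := 0) hu (.inr ⟨m, h0, ?_⟩)
    (.inr ⟨n, by simpa using hn, ?_⟩) (.inl (by simpa using hU))
  · rw [inner_add_right, real_inner_self_eq_norm_sq, hm]; linarith
  · rw [Complex.ofReal_zero, zero_mul, add_zero, inner_add_right, real_inner_self_eq_norm_sq, hn1,
      real_inner_comm]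
    linarith

/-- Every point of the unit circle lies in one of the two open sets or on a flat piece of their
common boundary. -/
def CircleFlat (U V : Set ℂ) : Prop :=
  ∀ w : ℂ, ‖w‖ = 1 → w ∈ U ∨ w ∈ V ∨ ∃ n, ‖n‖ = 1 ∧ Flat U V w n

theorem CircleFlat.swap (hc : CircleFlat U V) : CircleFlat V U := fun w hw => by
  rcases hc w hw with h | h | ⟨n, h1, h2⟩
  · exact .inr (.inl h)
  · exact .inl h
  · exact .inr (.inr ⟨-n, by rwa [norm_neg], h2.swap⟩)

theorem flat_rotate_of_tangential (h : TriangleFree U V η) (hc : CircleFlat U V) {m u n : ℂ}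
    (hm : ‖m‖ = 1) (h0 : Flat U V 0 m) (hu : ‖u‖ = 1) (hn1 : ‖n‖ = 1) (hn : Flat U V u n)
    (htan : inner ℝ n (Complex.I * u) = 0) (hne : n ≠ -m) : Flat U V (η * u) (-(η * n)) := by
  have hη : ‖η * u‖ = 1 := by rw [norm_mul, h.norm_eq, hu, one_mul]
  have hm0 : m ≠ 0 := norm_ne_zero_iff.1 (by rw [hm]; exact one_ne_zero)
  rcases hc _ hη with h1 | h1 | ⟨n', h1, h2⟩
  · exact (h.notMem_of_tangential hm h0 hu hn1 hn hne h1).elim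
  · exact (h.swap.notMem_of_tangential (by rwa [norm_neg]) h0.swap hu (by rwa [norm_neg]) hn.swap
      (by rwa [Ne, neg_inj]) h1).elim
  have htan' : inner ℝ n' (Complex.I * (η * u)) = 0 := by
    by_contra h3
    refine h.inv.transversal_rotate hm h0 hη h2 h3 hn1 ?_ ?_ <;>
      rwa [inv_mul_cancel_left₀ h.ne_zero]
  rcases eq_or_eq_neg_of_tangential hn1 hu htan with rfl | rfl <;>
  rcases eq_or_eq_neg_of_tangential h1 hη htan' with rfl | rfl
  · exact (h.swap.not_sweeps (k := 1) (neg_ne_zero.2 hm0) h0.swap hu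
      (sweeps_of_tangential (by rwa [norm_neg]) hu (by norm_num) hn.swap)
      (sweeps_of_tangential (by rwa [norm_neg]) hη (by norm_num) h2.swap)).elim
  · exact h2
  · rwa [mul_neg, neg_neg]
  · exact (h.not_sweeps (k := 1) hm0 h0 hu (sweeps_of_tangential hm hu (by norm_num) hn)
      (sweeps_of_tangential hm hη (by norm_num) h2)).elim

theorem not_flat_alternating (h : TriangleFree U V η) {m u n : ℂ} {b : ℝ} (h0 : Flat U V 0 m)
    (hu : ‖u‖ = 1) (hn1 : ‖n‖ = 1) (hn : Flat U V u n) (hn' : Flat U V (η * u) (-(η * n)))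
    (hb : 0 < inner ℝ m (n * (1 + b * Complex.I))) : -(1 / 2) ≤ b * η.im := by
  by_contra! hlt
  have hnn := sq_add_sq_of_norm hn1
  refine h.not_enters (a := 0) (k := 0) hu (.inr ⟨m, h0, hb⟩) (.inr ⟨n, by simpa using hn, ?_⟩)
    (.inr ⟨_, by simpa using hn', ?_⟩) <;>
  simp [h.re_eq]
  · nlinarith
  · nlinarith

/-- A circle tangent to the boundary touches it where the normal is opposite to the normal at the
centre. -/
theorem eq_neg_of_tangential (h : TriangleFree U V η) (hc : CircleFlat U V) {m u n : ℂ}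
    (hm : ‖m‖ = 1) (h0 : Flat U V 0 m) (hu : ‖u‖ = 1) (hn1 : ‖n‖ = 1) (hn : Flat U V u n)
    (htan : inner ℝ n (Complex.I * u) = 0) : n = -m := by
  by_contra hne
  have f1 := h.flat_rotate_of_tangential hc hm h0 hu hn1 hn htan hne
  have f2 := h.inv.flat_rotate_of_tangential hc hm h0 hu hn1 hn htan hne
  have hηη := sq_add_sq_of_norm h.norm_eq
  rw [h.re_eq] at hηη
  have hi : (η⁻¹).im = -η.im := by
    simp [Complex.inv_im, Complex.normSq_eq_norm_sq, h.norm_eq]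
  have key : ∀ b : ℝ, 1 < b ^ 2 → inner ℝ m n + b * inner ℝ m (Complex.I * n) ≤ 0 := by
    intro b hb
    by_contra! hlt
    have hb' : 0 < inner ℝ m (n * (1 + b * Complex.I)) := by
      have : n * (1 + b * Complex.I) = n + b • (Complex.I * n) := by
        rw [Complex.real_smul]; ring
      rwa [this, inner_add_right, inner_smul_right]
    have g1 := h.not_flat_alternating h0 hu hn1 hn f1 hb'
    have g2 := h.inv.not_flat_alternating h0 hu hn1 hn f2 hb'
    rw [hi] at g2
    have : (b * η.im) ^ 2 ≤ (1 / 2) ^ 2 := sq_le_sq' g1 (by linarith)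
    rw [mul_pow] at this
    nlinarith
  by_cases hβ : inner ℝ m (Complex.I * n) = 0
  · rcases eq_or_eq_neg_of_tangential hm hn1 hβ with rfl | rfl
    · have := key 2 (by norm_num)
      rw [hβ, real_inner_self_eq_norm_sq, hm] at this
      norm_num at this
    · simp at hne
  · have hle : |inner ℝ m (Complex.I * n)| ≤ 1 := by
      have := abs_real_inner_le_norm m (Complex.I * n)
      rwa [norm_mul, hm, hn1, Complex.norm_I, one_mul, one_mul] at this
    have h1 := neg_one_lt_inner hm hn1 hne
    have h2 := key (2 / inner ℝ m (Complex.I * n)) ?_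
    · rw [div_mul_cancel₀ _ hβ] at h2
      linarith
    · rw [div_pow, one_lt_div (by positivity)]
      have := sq_le_sq' (neg_le_of_abs_le hle) (le_of_abs_le hle)
      linarith

/-- The boundary crosses the unit circle transversally at `w`. -/
def Transversal (U V : Set ℂ) (w : ℂ) : Prop :=
  ‖w‖ = 1 ∧ ∃ n, ‖n‖ = 1 ∧ Flat U V w n ∧ inner ℝ n (Complex.I * w) ≠ 0

theorem Transversal.rotate {w : ℂ} (hw : Transversal U V w) (h : TriangleFree U V η)
    (hc : CircleFlat U V) (h0 : Flat U V 0 Complex.I) : Transversal U V (η * w) := by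
  obtain ⟨hw1, n, hn1, hn, htr⟩ := hw
  have hη : ‖η * w‖ = 1 := by rw [norm_mul, h.norm_eq, hw1, one_mul]
  obtain ⟨h1, h2⟩ := h.notMem_of_transversal Complex.I_ne_zero h0 hw1 (by rwa [zero_add]) htr
  rw [zero_add] at h1 h2
  obtain ⟨n', hn1', hn'⟩ := ((hc _ hη).resolve_left h1).resolve_left h2
  exact ⟨hη, n', hn1', hn',
    h.transversal_rotate Complex.norm_I h0 hw1 hn htr hn1' hn'⟩

theorem Transversal.zpow_rotate {w : ℂ} (hw : Transversal U V w) (h : TriangleFree U V η)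
    (hc : CircleFlat U V) (h0 : Flat U V 0 Complex.I) (k : ℤ) :
    Transversal U V (η ^ k * w) := by
  induction k with
  | zero => simpa
  | succ k ih =>
    rw [zpow_add_one₀ h.ne_zero, mul_comm (η ^ _), mul_assoc]
    exact ih.rotate h hc h0
  | pred k ih =>
    rw [zpow_sub_one₀ h.ne_zero, mul_comm (η ^ _), mul_assoc]
    exact ih.rotate h.inv hc h0

theorem eventually_inner_eq_zero (h : TriangleFree U V η) {ι : Type*} {l : Filter ι}
    {m w n n' : ℂ} (hm : m ≠ 0) (h0 : Flat U V 0 m) (hn : Flat U V w n)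
    (htr : inner ℝ n (Complex.I * w) ≠ 0) (hn' : Flat U V (η * w) n') {x u : ι → ℂ}
    (hx : Tendsto x l (𝓝 0)) (hu : Tendsto u l (𝓝 w)) (hxm : ∀ i, inner ℝ m (x i) = 0)
    (hu1 : ∀ i, ‖u i‖ = 1) (hxu : ∀ᶠ i in l, inner ℝ n (x i + (u i - w)) = 0) :
    ∀ᶠ i in l, inner ℝ n' (x i + (η * u i - η * w)) = 0 := by
  have t1 : Tendsto (fun i => x i + u i) l (𝓝 w) := by simpa using hx.add hu
  have t2 : Tendsto (fun i => x i + η * u i) l (𝓝 (η * w)) := by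
    simpa using hx.add (hu.const_mul η)
  have t3 : Tendsto (fun i => inner ℝ n (Complex.I * u i)) l (𝓝 (inner ℝ n (Complex.I * w))) :=
    tendsto_const_nhds.inner (hu.const_mul _)
  filter_upwards [hx.eventually h0.eventually_flat, t1.eventually hn.eventually_flat,
    t2.eventually hn', t3.eventually_ne htr, hxu] with i h1 h2 h3 h4 h5
  obtain ⟨h6, h7⟩ := h.notMem_of_transversal hm (h1 (by rw [sub_zero, hxm])) (hu1 i)
    (h2 (by rwa [add_sub_assoc])) h4
  rw [← add_sub_assoc]
  rcases lt_trichotomy (inner ℝ n' (x i + η * u i - η * w)) 0 with h8 | h8 | h8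
  · exact (h7 (h3.2.1 h8)).elim
  · exact h8
  · exact (h6 (h3.1 h8)).elim

theorem pow_three (h : TriangleFree U V η) : η ^ 3 = -1 := by
  have h1 := sq_add_sq_of_norm h.norm_eq
  rw [h.re_eq] at h1
  apply Complex.ext <;> simp [_root_.pow_succ, h.re_eq]
  · linarith
  · linear_combination η.im * (-h1)

theorem eq_zero_of_inner_eq_zero {N w : ℂ} {t : ℝ} (hw : w ≠ 0) (hs : Real.sin t ≠ 0)
    (hc : Real.cos t ≠ 1)
    (h1 : inner ℝ N (w * Complex.exp ((t : ℝ) * Complex.I) - w) = 0)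
    (h2 : inner ℝ N (w * Complex.exp (((-t : ℝ) : ℂ) * Complex.I) - w) = 0) : N = 0 := by
  simp only [inner_eq_re_im, Complex.sub_re, Complex.sub_im, Complex.mul_re, Complex.mul_im,
    Complex.exp_ofReal_mul_I_re, Complex.exp_ofReal_mul_I_im, Real.cos_neg, Real.sin_neg] at h1 h2
  have h3 : N.re * w.re + N.im * w.im = 0 := by
    have : (Real.cos t - 1) * (N.re * w.re + N.im * w.im) = 0 := by
      linear_combination (h1 + h2) / 2
    exact (mul_eq_zero.1 this).resolve_left (sub_ne_zero.2 hc)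
  have h4 : N.im * w.re - N.re * w.im = 0 := by
    have : Real.sin t * (N.im * w.re - N.re * w.im) = 0 := by
      linear_combination (h1 - h2) / 2
    exact (mul_eq_zero.1 this).resolve_left hs
  have h5 : w.re * w.re + w.im * w.im ≠ 0 := by
    rw [← Complex.normSq_apply]; exact (map_ne_zero _).2 hw
  apply Complex.ext
  · refine (mul_eq_zero.1 ?_).resolve_left h5
    linear_combination w.re * h3 - w.im * h4
  · refine (mul_eq_zero.1 ?_).resolve_left h5
    linear_combination w.im * h3 + w.re * h4

/-- At a transversal crossing, the boundary is parallel to the boundary at the centre. -/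
theorem re_eq_zero_of_transversal (h : TriangleFree U V η) (hc : CircleFlat U V)
    (h0 : Flat U V 0 Complex.I) {w n : ℂ} (hw1 : ‖w‖ = 1) (hn1 : ‖n‖ = 1) (hn : Flat U V w n)
    (htr : inner ℝ n (Complex.I * w) ≠ 0) : n.re = 0 := by
  by_contra ha
  have T0 : Transversal U V w := ⟨hw1, n, hn1, hn, htr⟩
  have T1 := T0.rotate h hc h0
  have T2 := T1.rotate h hc h0
  have T3 := T2.rotate h hc h0
  obtain ⟨-, n₁, -, hn₁, htr₁⟩ := T1
  obtain ⟨-, n₂, -, hn₂, htr₂⟩ := T2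
  obtain ⟨-, n₃, hn₃1, hn₃, -⟩ := T3
  set e : ℝ → ℂ := fun t => w * Complex.exp (t * Complex.I) with he
  set x : ℝ → ℂ := fun t => ((-inner ℝ n (e t - w) / n.re : ℝ) : ℂ) with hxdef
  have hce : Continuous e := by fun_prop
  have hcx : Continuous x := by
    refine Complex.continuous_ofReal.comp ?_
    exact ((continuous_const.inner (hce.sub continuous_const)).neg).div_const _
  have hte : Tendsto e (𝓝 0) (𝓝 w) := by simpa [he] using hce.tendsto 0
  have htx : Tendsto x (𝓝 0) (𝓝 0) := by simpa [hxdef, he] using hcx.tendsto 0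
  have hxm : ∀ t, inner ℝ Complex.I (x t) = 0 := fun t => by simp [hxdef]
  have he1 : ∀ t, ‖e t‖ = 1 := fun t => by
    rw [he, norm_mul, hw1, Complex.norm_exp_ofReal_mul_I, one_mul]
  have hxre : ∀ (N : ℂ) (t : ℝ), inner ℝ N (x t) = N.re * (-inner ℝ n (e t - w) / n.re) :=
    fun N t => by rw [inner_eq_re_im]; simp [hxdef]
  have E0 : ∀ᶠ t in 𝓝 (0 : ℝ), inner ℝ n (x t + (e t - w)) = 0 := .of_forall fun t => by
    rw [inner_add_right, hxre]
    field_simp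
    ring
  have hη1 : ∀ z : ℂ, ‖z‖ = 1 → ‖η * z‖ = 1 := fun z hz => by
    rw [norm_mul, h.norm_eq, hz, one_mul]
  have E1 := h.eventually_inner_eq_zero Complex.I_ne_zero h0 hn htr hn₁ htx hte hxm he1 E0
  have E2 := h.eventually_inner_eq_zero Complex.I_ne_zero h0 hn₁ htr₁ hn₂ htx (hte.const_mul η)
    hxm (fun t => hη1 _ (he1 t)) E1
  have E3 := h.eventually_inner_eq_zero Complex.I_ne_zero h0 hn₂ htr₂ hn₃ htx
    ((hte.const_mul η).const_mul η) hxm (fun t => hη1 _ (hη1 _ (he1 t))) E2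
  have hηηη : ∀ z : ℂ, η * (η * (η * z)) = -z := fun z => by
    linear_combination z * h.pow_three
  simp only [hηηη] at E3
  have E4 : ∀ᶠ t in 𝓝 (0 : ℝ), inner ℝ (n₃.re • n + n.re • n₃) (e t - w) = 0 := by
    filter_upwards [E3] with t ht
    rw [show -e t - -w = -(e t - w) by ring, inner_add_right, hxre, inner_neg_right] at ht
    rw [inner_add_left, real_inner_smul_left, real_inner_smul_left]
    field_simp at ht
    linarith
  have E5 : ∀ᶠ t in 𝓝 (0 : ℝ), inner ℝ (n₃.re • n + n.re • n₃) (e (-t) - w) = 0 := by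
    have : Tendsto (fun t : ℝ => -t) (𝓝 0) (𝓝 0) := by simpa using (continuous_neg.tendsto (0 : ℝ))
    exact this.eventually E4
  have E6 : ∀ᶠ t in 𝓝[>] (0 : ℝ), t < 1 :=
    (eventually_lt_nhds one_pos).filter_mono nhdsWithin_le_nhds
  obtain ⟨t, ⟨ht4, ht5⟩, ht6, ht7⟩ :=
    (((E4.and E5).filter_mono nhdsWithin_le_nhds).and (E6.and self_mem_nhdsWithin)).exists
  have ht7 : 0 < t := ht7
  have hsin : 0 < Real.sin t := Real.sin_pos_of_pos_of_lt_pi ht7 (by linarith [Real.pi_gt_three])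
  have hcos : Real.cos t ≠ 1 := fun hcos => by
    have := Real.sin_sq_add_cos_sq t
    rw [hcos] at this
    nlinarith
  have hN := eq_zero_of_inner_eq_zero (norm_ne_zero_iff.1 (by rw [hw1]; exact one_ne_zero))
    hsin.ne' hcos ht4 ht5
  have hre := congrArg Complex.re hN
  simp only [Complex.add_re, Complex.smul_re, smul_eq_mul, Complex.zero_re] at hre
  have hc0 : n₃.re = 0 := by
    have : n₃.re * n.re = 0 := by linarith
    exact (mul_eq_zero.1 this).resolve_right ha
  rw [hc0, zero_smul, zero_add, smul_eq_zero] at hN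
  rw [hN.resolve_left ha, norm_zero] at hn₃1
  exact zero_ne_one hn₃1

theorem eq_I_or_eq_neg_I {n : ℂ} (hn : ‖n‖ = 1) (hre : n.re = 0) :
    n = Complex.I ∨ n = -Complex.I := by
  have h1 := sq_add_sq_of_norm hn
  rw [hre, zero_pow two_ne_zero, zero_add] at h1
  rcases sq_eq_one_iff.1 h1 with h2 | h2
  · exact .inl (Complex.ext (by simpa using hre) (by simpa using h2))
  · exact .inr (Complex.ext (by simpa using hre) (by simpa using h2))

theorem normal_eq_neg_I (h : TriangleFree U V η) (h0 : Flat U V 0 Complex.I) {u n n' : ℂ}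
    (hu : ‖u‖ = 1) (hn1 : ‖n‖ = 1) (hre : n.re = 0) (hn : Flat U V u n) (hn1' : ‖n'‖ = 1)
    (hre' : n'.re = 0) (hn' : Flat U V (η * u) n') (hpos : 0 < u.re) (hlt : u.re < (η * u).re) :
    n = -Complex.I := by
  refine (eq_I_or_eq_neg_I hn1 hre).resolve_left ?_
  rintro rfl
  have hin : ∀ (k : ℝ) (z : ℂ),
      inner ℝ Complex.I (Complex.I + k * (Complex.I * z)) = 1 + k * z.re := fun k z => by
    simp
  have h1 : Enters U V 0 Complex.I := .inr ⟨_, h0, by simp⟩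
  rcases eq_I_or_eq_neg_I hn1' hre' with rfl | rfl
  · refine h.not_enters (a := 0) (v := Complex.I) (k := 1) hu h1
      (.inr ⟨_, by simpa using hn, ?_⟩) (.inr ⟨_, by simpa using hn', ?_⟩) <;> rw [hin] <;>
    linarith
  · obtain ⟨r, hr1, hr2⟩ := exists_between hlt
    have hr : 0 < r := hpos.trans hr1
    refine h.not_enters (a := 0) (v := Complex.I) (k := -r⁻¹) hu h1
      (.inr ⟨_, by simpa using hn, ?_⟩) (.inr ⟨_, by simpa using hn', ?_⟩)
    · rw [hin]
      have : r⁻¹ * u.re < 1 := by rw [inv_mul_lt_iff₀ hr]; linarith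
      linarith
    · rw [inner_neg_left, hin]
      have : 1 < r⁻¹ * (η * u).re := by rw [lt_inv_mul_iff₀ hr]; linarith
      linarith

end TriangleFree

/-- The point of the unit circle with argument `t`. -/
def circ (t : ℝ) : ℂ := Complex.exp (t * Complex.I)

theorem norm_circ (t : ℝ) : ‖circ t‖ = 1 := Complex.norm_exp_ofReal_mul_I t

theorem re_circ (t : ℝ) : (circ t).re = Real.cos t := Complex.exp_ofReal_mul_I_re t

theorem im_circ (t : ℝ) : (circ t).im = Real.sin t := Complex.exp_ofReal_mul_I_im t

theorem circ_add (s t : ℝ) : circ (s + t) = circ s * circ t := by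
  simp [circ, add_mul, Complex.exp_add]

theorem circ_neg (t : ℝ) : circ (-t) = (circ t)⁻¹ := by
  simp [circ, Complex.exp_neg]

theorem circ_int_mul (k : ℤ) (t : ℝ) : circ (k * t) = circ t ^ k := by
  simp [circ, ← Complex.exp_int_mul, mul_assoc]

theorem continuous_circ : Continuous circ := by unfold circ; fun_prop

theorem exists_circ_eq {w : ℂ} (hw : ‖w‖ = 1) : ∃ t, circ t = w :=
  (Complex.norm_eq_one_iff w).1 hw

/-- A path leaving a point into `V` and arriving from `U` cannot cross the boundary only
from `U` to `V`. -/
theorem false_of_crossings {X : Type*} [TopologicalSpace X] {U V : Set X} (hU : IsOpen U)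
    (hV : IsOpen V) (hd : Disjoint U V) {e : ℝ → X} (he : Continuous e) {a b : ℝ} (hab : a < b)
    (ha : ∀ᶠ t in 𝓝[>] a, e t ∈ V) (hb : ∀ᶠ t in 𝓝[<] b, e t ∈ U)
    (hcr : ∀ c ∈ Set.Ioo a b, e c ∈ U ∨ e c ∈ V ∨ ∀ᶠ t in 𝓝[<] c, e t ∈ U) : False := by
  set K := {t | t ∈ Set.Ioo a b ∧ e t ∉ V} with hK
  have hUV : ∀ t, e t ∈ U → e t ∉ V := fun t h1 h2 => Set.disjoint_left.1 hd h1 h2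
  obtain ⟨b', hb'U, hb'⟩ := (hb.and (Ioo_mem_nhdsLT hab)).exists
  have hb'K : b' ∈ K := ⟨hb', hUV _ hb'U⟩
  have hbdd : BddBelow K := ⟨a, fun t ht => ht.1.1.le⟩
  have hglb := isGLB_csInf ⟨b', hb'K⟩ hbdd
  set c := sInf K
  obtain ⟨a', haa', ha'⟩ := (mem_nhdsGT_iff_exists_Ioo_subset).1 ha
  have hac : a < c := by
    refine lt_of_lt_of_le haa' (hglb.2 fun t ht => ?_)
    by_contra! hlt
    exact ht.2 (ha' ⟨ht.1.1, hlt⟩)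
  have hcb : c < b := (hglb.1 hb'K).trans_lt hb'.2
  have hbefore : ∀ t ∈ Set.Ioo a c, e t ∈ V := fun t ht => by
    by_contra hn
    exact absurd (hglb.1 ⟨⟨ht.1, ht.2.trans hcb⟩, hn⟩) (not_le.2 ht.2)
  have hcV : e c ∉ V := fun hc => by
    obtain ⟨c', hcc', hc'⟩ := mem_nhdsGE_iff_exists_Ico_subset.1
      (nhdsWithin_le_nhds (he.continuousAt.preimage_mem_nhds (hV.mem_nhds hc)) :
        e ⁻¹' V ∈ 𝓝[≥] c)
    have : c' ≤ c := hglb.2 fun t ht => by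
      by_contra! hlt
      exact ht.2 (hc' ⟨hglb.1 ht, hlt⟩)
    exact absurd this (not_le.2 hcc')
  have hcU : ∀ᶠ t in 𝓝[<] c, e t ∈ U := by
    rcases hcr c ⟨hac, hcb⟩ with h1 | h1 | h1
    · exact nhdsWithin_le_nhds (he.continuousAt.preimage_mem_nhds (hU.mem_nhds h1))
    · exact (hcV h1).elim
    · exact h1
  obtain ⟨t, ht1, ht2⟩ := (hcU.and (Ioo_mem_nhdsLT hac)).exists
  exact hUV t ht1 (hbefore t ht2)

section Hexagon

variable {U V : Set ℂ}

theorem eventually_lt_mem_of_flat {c : ℝ} (hf : Flat U V (circ c) (-Complex.I))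
    (hc1 : -(π / 2) < c) (hc2 : c ≤ π / 2) : ∀ᶠ t in 𝓝[<] c, circ t ∈ U := by
  have h1 := (continuous_circ.tendsto c).mono_left (nhdsWithin_le_nhds (s := Set.Iio c))
  filter_upwards [h1.eventually hf, Ioo_mem_nhdsLT hc1] with t ht ht'
  refine ht.1 ?_
  simpa [inner_eq_re_im, im_circ] using
    Real.strictMonoOn_sin ⟨ht'.1.le, ht'.2.le.trans hc2⟩ ⟨hc1.le, hc2⟩ ht'.2

theorem eventually_gt_mem_of_flat {c : ℝ} (hf : Flat U V (circ c) (-Complex.I))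
    (hc1 : -(π / 2) ≤ c) (hc2 : c < π / 2) : ∀ᶠ t in 𝓝[>] c, circ t ∈ V := by
  have h1 := (continuous_circ.tendsto c).mono_left (nhdsWithin_le_nhds (s := Set.Ioi c))
  filter_upwards [h1.eventually hf, Ioo_mem_nhdsGT hc2] with t ht ht'
  refine ht.2.1 ?_
  simpa [inner_eq_re_im, im_circ] using
    Real.strictMonoOn_sin ⟨hc1, hc2.le⟩ ⟨hc1.trans ht'.1.le, ht'.2.le⟩ ht'.1

/-- Two boundary points on an arc of the right half circle cannot both have the normal `-I` if all
the boundary points between them do. -/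
theorem false_of_flat_arc {η : ℂ} (h : TriangleFree U V η) (hc : TriangleFree.CircleFlat U V)
    {a b : ℝ} (ha : -(π / 2) ≤ a) (hab : a < b) (hb : b ≤ π / 2)
    (hfa : Flat U V (circ a) (-Complex.I)) (hfb : Flat U V (circ b) (-Complex.I))
    (hcr : ∀ c ∈ Set.Ioo a b, ∀ n, ‖n‖ = 1 → Flat U V (circ c) n → n = -Complex.I) : False := by
  refine false_of_crossings h.isOpen_left h.isOpen_right h.disjoint continuous_circ hab
    (eventually_gt_mem_of_flat hfa ha (hab.trans_le hb))
    (eventually_lt_mem_of_flat hfb (ha.trans_lt hab) hb) fun c hcI => ?_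
  rcases hc _ (norm_circ c) with h1 | h1 | ⟨n, h1, h2⟩
  · exact .inl h1
  · exact .inr (.inl h1)
  · rw [hcr c hcI n h1 h2] at h2
    exact .inr (.inr (eventually_lt_mem_of_flat h2 (ha.trans_lt hcI.1) (hcI.2.le.trans hb)))

theorem re_circ_pos {t : ℝ} (h1 : -(π / 2) < t) (h2 : t < π / 2) : 0 < (circ t).re := by
  rw [re_circ]; exact Real.cos_pos_of_mem_Ioo ⟨h1, h2⟩

theorem tangential_re_eq_zero {w : ℂ} (htan : inner ℝ (-Complex.I) (Complex.I * w) = 0) :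
    w.re = 0 := by
  simpa [inner_eq_re_im] using htan

open TriangleFree in
theorem transversal_of_re_ne_zero {η : ℂ} (h : TriangleFree U V η) (hc : CircleFlat U V)
    (h0 : Flat U V 0 Complex.I) {w n : ℂ} (hw : ‖w‖ = 1) (hn1 : ‖n‖ = 1) (hn : Flat U V w n)
    (hre : w.re ≠ 0) : inner ℝ n (Complex.I * w) ≠ 0 := fun htan => by
  have := h.eq_neg_of_tangential hc Complex.norm_I h0 hw hn1 hn htan
  rw [this] at htan
  exact hre (tangential_re_eq_zero htan)

open TriangleFree in
theorem exists_transversal (h : TriangleFree U V (circ (π / 3))) (hc : CircleFlat U V)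
    (h0 : Flat U V 0 Complex.I) :
    ∃ t ∈ Set.Icc (-(π / 6)) (π / 6), Transversal U V (circ t) := by
  by_contra! hno
  have hπ := Real.pi_pos
  have hsub : circ '' Set.Icc (-(π / 6)) (π / 6) ⊆ U ∪ V := by
    rintro _ ⟨t, ht, rfl⟩
    rcases hc _ (norm_circ t) with h1 | h1 | ⟨n, h1, h2⟩
    · exact .inl h1
    · exact .inr h1
    · refine (hno t ht ⟨norm_circ t, n, h1, h2, ?_⟩).elim
      refine transversal_of_re_ne_zero h hc h0 (norm_circ t) h1 h2 (re_circ_pos ?_ ?_).ne'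
      · linarith [ht.1]
      · linarith [ht.2]
  have m1 : circ (-(π / 6)) ∈ circ '' Set.Icc (-(π / 6)) (π / 6) :=
    Set.mem_image_of_mem _ ⟨le_rfl, by linarith⟩
  have m2 : circ (π / 6) ∈ circ '' Set.Icc (-(π / 6)) (π / 6) :=
    Set.mem_image_of_mem _ ⟨by linarith, le_rfl⟩
  have hrot : circ (π / 6) = circ (π / 3) * circ (-(π / 6)) := by
    rw [← circ_add]; ring_nf
  rcases (isPreconnected_Icc.image _ continuous_circ.continuousOn).subset_or_subset h.isOpen_left
    h.isOpen_right h.disjoint hsub with hs | hs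
  · exact h.not_mem_and_mem Complex.I_ne_zero h0 (norm_circ (-(π / 6)))
      ⟨by simpa using hs m1, by rw [zero_add, ← hrot]; exact hs m2⟩
  · exact h.swap.not_mem_and_mem (neg_ne_zero.2 Complex.I_ne_zero) h0.swap (norm_circ (-(π / 6)))
      ⟨by simpa using hs m1, by rw [zero_add, ← hrot]; exact hs m2⟩

open TriangleFree in
/-- The boundary points on the unit circle about a flat boundary point form a regular hexagon, and
the boundary at them is parallel to the boundary at the centre. -/
theorem hexagon (h : TriangleFree U V (circ (π / 3))) (hc : CircleFlat U V)
    (h0 : Flat U V 0 Complex.I) :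
    ∃ u : ℂ, ‖u‖ = 1 ∧
      (∀ w : ℂ, ‖w‖ = 1 → (w ∉ U ∧ w ∉ V ↔ ∃ k : ℤ, w = circ (k * (π / 3)) * u)) ∧
      ∀ w n : ℂ, ‖w‖ = 1 → ‖n‖ = 1 → Flat U V w n → n.re = 0 := by
  have hπ := Real.pi_pos
  have hrot : ∀ t : ℝ, circ (t + π / 3) = circ (π / 3) * circ t := fun t => by
    rw [circ_add, mul_comm]
  have hrot' : ∀ t : ℝ, circ (t - π / 3) = (circ (π / 3))⁻¹ * circ t := fun t => by
    rw [sub_eq_add_neg, circ_add, circ_neg, mul_comm]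
  have htr_add : ∀ t : ℝ, Transversal U V (circ t) → Transversal U V (circ (t + π / 3)) :=
    fun t ht => by rw [hrot]; exact ht.rotate h hc h0
  have htr_sub : ∀ t : ℝ, Transversal U V (circ t) → Transversal U V (circ (t - π / 3)) :=
    fun t ht => by rw [hrot']; exact ht.rotate h.inv hc h0
  have htr_re : ∀ w, Transversal U V w → w.re ≠ 0 := by
    rintro w ⟨hw, n, hn1, hn, htr⟩ hre
    have := h.re_eq_zero_of_transversal hc h0 hw hn1 hn htr
    exact htr (by simp [this, hre])
  have hnormal_re : ∀ t n, ‖n‖ = 1 → Flat U V (circ t) n → (circ t).re ≠ 0 →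
      Transversal U V (circ t) ∧ n.re = 0 := fun t n hn1 hn hre => by
    have htr := transversal_of_re_ne_zero h hc h0 (norm_circ t) hn1 hn hre
    exact ⟨⟨norm_circ t, n, hn1, hn, htr⟩,
      h.re_eq_zero_of_transversal hc h0 (norm_circ t) hn1 hn htr⟩
  have hupper : ∀ t ∈ Set.Ioo (π / 6) (π / 2), ∀ n, ‖n‖ = 1 → Flat U V (circ t) n →
      n = -Complex.I := by
    intro t ht n hn1 hn
    have hpos := re_circ_pos (by linarith [ht.1]) ht.2
    obtain ⟨htr, hre⟩ := hnormal_re t n hn1 hn hpos.ne'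
    obtain ⟨-, n', hn1', hn', htr'⟩ := htr_sub t htr
    have hre' := h.re_eq_zero_of_transversal hc h0 (norm_circ _) hn1' hn' htr'
    rw [hrot'] at hn'
    refine h.inv.normal_eq_neg_I h0 (norm_circ t) hn1 hre hn hn1' hre' hn' hpos ?_
    rw [← hrot', re_circ, re_circ, ← Real.cos_abs (t - π / 3)]
    refine Real.cos_lt_cos_of_nonneg_of_le_pi (abs_nonneg _) (by linarith [ht.2]) ?_
    rw [abs_lt]
    constructor <;> linarith [ht.1]
  have hlower : ∀ t ∈ Set.Ioo (-(π / 2)) (-(π / 6)), ∀ n, ‖n‖ = 1 → Flat U V (circ t) n →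
      n = -Complex.I := by
    intro t ht n hn1 hn
    have hpos := re_circ_pos ht.1 (by linarith [ht.2])
    obtain ⟨htr, hre⟩ := hnormal_re t n hn1 hn hpos.ne'
    obtain ⟨-, n', hn1', hn', htr'⟩ := htr_add t htr
    have hre' := h.re_eq_zero_of_transversal hc h0 (norm_circ _) hn1' hn' htr'
    rw [hrot] at hn'
    refine h.normal_eq_neg_I h0 (norm_circ t) hn1 hre hn hn1' hre' hn' hpos ?_
    rw [← hrot, re_circ, re_circ, ← Real.cos_abs (t + π / 3), ← Real.cos_abs t]
    rw [abs_of_neg (by linarith [ht.2] : t < 0)]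
    refine Real.cos_lt_cos_of_nonneg_of_le_pi (abs_nonneg _) (by linarith [ht.1]) ?_
    rw [abs_lt]
    constructor <;> linarith [ht.2]
  have hre_top : (circ (π / 2)).re = 0 := by rw [re_circ, Real.cos_pi_div_two]
  have hre_bot : (circ (-(π / 2))).re = 0 := by rw [re_circ, Real.cos_neg, Real.cos_pi_div_two]
  obtain ⟨t₀, ht₀, htr₀⟩ := exists_transversal h hc h0
  have ht₀1 : -(π / 6) < t₀ := by
    refine lt_of_le_of_ne ht₀.1 fun heq => htr_re _ (htr_sub _ htr₀) ?_
    rw [← heq, ← hre_bot]; ring_nf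
  have ht₀2 : t₀ < π / 6 := by
    refine lt_of_le_of_ne ht₀.2 fun heq => htr_re _ (htr_add _ htr₀) ?_
    rw [heq, ← hre_top]; ring_nf
  obtain ⟨-, n₁, hn₁1, hn₁, -⟩ := htr_add _ htr₀
  obtain ⟨-, n₂, hn₂1, hn₂, -⟩ := htr_sub _ htr₀
  rw [hupper _ ⟨by linarith, by linarith⟩ n₁ hn₁1 hn₁] at hn₁
  rw [hlower _ ⟨by linarith, by linarith⟩ n₂ hn₂1 hn₂] at hn₂
  have hall : ∀ w n, ‖w‖ = 1 → ‖n‖ = 1 → Flat U V w n → inner ℝ n (Complex.I * w) ≠ 0 := by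
    intro w n hw hn1 hn htan
    have hneg := h.eq_neg_of_tangential hc Complex.norm_I h0 hw hn1 hn htan
    rw [hneg] at htan hn
    rcases eq_I_or_eq_neg_I hw (tangential_re_eq_zero htan) with rfl | rfl
    · have htop : circ (π / 2) = Complex.I := by
        apply Complex.ext <;> simp [re_circ, im_circ]
      exact false_of_flat_arc h hc (by linarith) (by linarith) le_rfl hn₁ (by rwa [htop])
        fun c hcI => hupper c ⟨by linarith [hcI.1], hcI.2⟩
    · have hbot : circ (-(π / 2)) = -Complex.I := by
        apply Complex.ext <;> simp [re_circ, im_circ]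
      exact false_of_flat_arc h hc le_rfl (by linarith) (by linarith) (by rwa [hbot]) hn₂
        fun c hcI => hlower c ⟨hcI.1, by linarith [hcI.2]⟩
  refine ⟨circ t₀, norm_circ t₀, fun w hw => ⟨fun hmem => ?_, ?_⟩, fun w n hw hn1 hn =>
    h.re_eq_zero_of_transversal hc h0 hw hn1 hn (hall w n hw hn1 hn)⟩
  · obtain ⟨n, hn1, hn⟩ := ((hc w hw).resolve_left hmem.1).resolve_left hmem.2
    obtain ⟨θ, rfl⟩ := exists_circ_eq hw
    have hT : Transversal U V (circ θ) := ⟨hw, n, hn1, hn, hall _ n hw hn1 hn⟩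
    have hp : (0 : ℝ) < π / 3 := by positivity
    set k := toIcoDiv hp (π / 6) θ with hk
    set θ' := θ - k * (π / 3) with hθ'
    have hmemI : θ' ∈ Set.Ico (π / 6) (π / 6 + π / 3) := by
      have := sub_toIcoDiv_zsmul_mem_Ico hp (π / 6) θ
      rwa [zsmul_eq_mul] at this
    have hT' : Transversal U V (circ θ') := by
      have := hT.zpow_rotate h hc h0 (-k)
      rw [← circ_int_mul, ← circ_add] at this
      convert this using 2
      push_cast; ring
    have hlt : π / 6 < θ' := by
      refine lt_of_le_of_ne hmemI.1 fun heq => htr_re _ (htr_add _ hT') ?_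
      rw [← heq, ← hre_top]; ring_nf
    have hlt2 : θ' < π / 2 := by linarith [hmemI.2]
    obtain ⟨-, n', hn1', hn', -⟩ := hT'
    rw [hupper _ ⟨hlt, hlt2⟩ n' hn1' hn'] at hn'
    have heq : θ' = t₀ + π / 3 := by
      rcases lt_trichotomy θ' (t₀ + π / 3) with h1 | h1 | h1
      · exact (false_of_flat_arc h hc (by linarith) h1 (by linarith) hn' hn₁
          fun c hcI => hupper c ⟨by linarith [hcI.1], by linarith [hcI.2]⟩).elim
      · exact h1
      · exact (false_of_flat_arc h hc (by linarith) h1 (by linarith) hn₁ hn'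
          fun c hcI => hupper c ⟨by linarith [hcI.1], by linarith [hcI.2]⟩).elim
    refine ⟨k + 1, ?_⟩
    rw [← circ_add]
    congr 1
    push_cast
    linarith
  · rintro ⟨k, rfl⟩
    rw [circ_int_mul]
    obtain ⟨-, n, -, hn, -⟩ := htr₀.zpow_rotate h hc h0 k
    exact hn.notMem

end Hexagon

section Local

/-- The Euclidean plane. -/
local notation "Plane" => EuclideanSpace ℝ (Fin 2)

theorem exists_unit_normal {d : Plane} (hd : d ≠ 0) :
    ∃ n : Plane, ‖n‖ = 1 ∧ (ℝ ∙ n)ᗮ = ℝ ∙ d := by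
  have : Fact (Module.finrank ℝ Plane = 1 + 1) := ⟨by simp⟩
  have h1 : Module.finrank ℝ (ℝ ∙ d)ᗮ = 1 := Submodule.finrank_orthogonal_span_singleton hd
  obtain ⟨w, hw, hw0⟩ : ∃ w ∈ (ℝ ∙ d)ᗮ, w ≠ 0 := by
    refine Submodule.exists_mem_ne_zero_of_ne_bot fun hbot => ?_
    rw [hbot, finrank_bot] at h1
    exact zero_ne_one h1
  have hwn : ‖w‖⁻¹ • w ≠ 0 := smul_ne_zero (inv_ne_zero (norm_ne_zero_iff.2 hw0)) hw0
  refine ⟨‖w‖⁻¹ • w, norm_smul_inv_norm hw0, (Submodule.eq_of_le_of_finrank_eq ?_ ?_).symm⟩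
  · rw [Submodule.span_singleton_le_iff_mem, Submodule.mem_orthogonal_singleton_iff_inner_right,
      real_inner_smul_left, real_inner_comm,
      Submodule.mem_orthogonal_singleton_iff_inner_right.1 hw, mul_zero]
  · rw [finrank_span_singleton hd, Submodule.finrank_orthogonal_span_singleton (n := 1) hwn]

theorem span_singleton_neg_eq (n : Plane) : (ℝ ∙ (-n)) = ℝ ∙ n := by
  rw [← Set.neg_singleton, Submodule.span_neg]

theorem IsPolygonal.exists_normal {B : Set Plane} {S : Set (Set Plane)} (h : IsPolygonal B S)
    {t : Set Plane} (ht : t ∈ S) {P : Plane} (hP : P ∈ t) (hv : ¬ IsVertex S P) :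
    ∃ n : Plane, ‖n‖ = 1 ∧ (∀ᶠ Q in 𝓝 P, Q ∈ frontier B ↔ inner ℝ n (Q - P) = 0) ∧
      ∀ l : AffineSubspace ℝ Plane, IsLine l → t ⊆ l → l.direction = (ℝ ∙ n)ᗮ := by
  obtain ⟨-, -, ⟨x, hx, y, hy, hxy⟩, l, hl, htl⟩ := h.seg t ht
  have hd : y - x ≠ 0 := sub_ne_zero.2 hxy.symm
  have hdir : ∀ l : AffineSubspace ℝ Plane, IsLine l → t ⊆ l → l.direction = ℝ ∙ (y - x) := by
    intro l hl htl
    have hmem : y - x ∈ l.direction := AffineSubspace.vsub_mem_direction (htl hy) (htl hx)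
    have := hl.2
    symm
    apply Submodule.eq_of_le_of_finrank_eq
    · rwa [Submodule.span_singleton_le_iff_mem]
    · rw [finrank_span_singleton hd, hl.2]
  obtain ⟨n, hn1, hn⟩ := exists_unit_normal hd
  have hiff : ∀ v : Plane, v ∈ ℝ ∙ (y - x) ↔ inner ℝ n v = 0 := fun v => by
    rw [← hn, Submodule.mem_orthogonal_singleton_iff_inner_right]
  refine ⟨n, hn1, ?_, fun l hl htl => by rw [hdir l hl htl, hn]⟩
  have hrel : P ∈ intrinsicInterior ℝ t := by
    by_contra hni
    exact hv ⟨t, ht, hP, hni⟩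
  have hin : ∀ᶠ Q in 𝓝 P, inner ℝ n (Q - P) = 0 → Q ∈ t := by
    obtain ⟨p, hp, hpP⟩ := mem_intrinsicInterior.1 hrel
    have hp' := mem_interior_iff_mem_nhds.1 hp
    rw [nhds_subtype_eq_comap, Filter.mem_comap, hpP] at hp'
    obtain ⟨N, hN, hNt⟩ := hp'
    filter_upwards [hN] with Q hQ hQP
    have hQs : Q ∈ affineSpan ℝ t := by
      have h1 : Q - P ∈ (affineSpan ℝ t).direction := by
        refine (?_ : ℝ ∙ (y - x) ≤ _) ((hiff _).2 hQP)
        rw [Submodule.span_singleton_le_iff_mem]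
        exact AffineSubspace.vsub_mem_direction (subset_affineSpan ℝ t hy)
          (subset_affineSpan ℝ t hx)
      have := AffineSubspace.vadd_mem_of_mem_direction h1 (subset_affineSpan ℝ t hP)
      simpa using this
    exact hNt (show (⟨Q, hQs⟩ : affineSpan ℝ t) ∈ Subtype.val ⁻¹' N from hQ)
  have hother : ∀ᶠ Q in 𝓝 P, ∀ s ∈ {s ∈ S | (s ∩ Metric.ball P 1).Nonempty}, s ≠ t → Q ∉ s := by
    refine (Filter.eventually_all_finite (h.loc_finite _ Metric.isBounded_ball)).2 ?_
    intro s hs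
    by_cases hst : s = t
    · exact .of_forall fun Q hne => (hne hst).elim
    · have hPs : P ∉ s := fun hPs =>
        hv ⟨t, ht, (h.inter_endpoint s hs.1 t ht hst P ⟨hPs, hP⟩).2⟩
      filter_upwards [(h.seg s hs.1).1.isOpen_compl.mem_nhds hPs] with Q hQ _ using hQ
  filter_upwards [hin, hother, Metric.ball_mem_nhds P one_pos] with Q h1 h2 h3
  rw [h.boundary]
  refine ⟨?_, fun hQ => ⟨t, ht, h1 hQ⟩⟩
  rintro ⟨s, hs, hQs⟩
  have hst : s = t := by
    by_contra hne
    exact h2 s ⟨hs, Q, hQs, h3⟩ hne hQs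
  rw [hst] at hQs
  rw [← hiff, ← hdir l hl htl]
  exact AffineSubspace.vsub_mem_direction (htl hQs) (htl hP)

theorem subset_interior_or_of_disjoint_frontier {X : Type*} [TopologicalSpace X] {B K : Set X}
    (hK : IsPreconnected K) (hd : Disjoint K (frontier B)) :
    K ⊆ interior B ∨ K ⊆ interior Bᶜ := by
  refine hK.subset_or_subset isOpen_interior isOpen_interior
    (disjoint_compl_right.mono interior_subset interior_subset) fun x hx => ?_
  have := Set.disjoint_left.1 hd hx
  rw [interior_compl]
  by_contra hn
  simp only [Set.mem_union, not_or, Set.mem_compl_iff, not_not] at hn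
  exact this ⟨hn.2, hn.1⟩

theorem notMem_interior_of_mem_frontier {X : Type*} [TopologicalSpace X] {B : Set X} {x : X}
    (hx : x ∈ frontier B) : x ∉ interior B ∧ x ∉ interior Bᶜ := by
  rw [interior_compl]
  exact ⟨hx.2, fun h => h hx.1⟩

/-- If a hyperplane is locally the frontier of `B`, then its two sides cannot both be in the
interior of `B`. -/
theorem false_of_two_sides {E : Type*} [NormedAddCommGroup E] [InnerProductSpace ℝ E] {B : Set E}
    (hW : Bᶜ ⊆ closure (interior Bᶜ)) {P n : E} (hP : P ∈ frontier B)
    (hfr : ∀ᶠ Q in 𝓝 P, Q ∈ frontier B ↔ inner ℝ n (Q - P) = 0)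
    (h1 : ∀ᶠ Q in 𝓝 P, 0 < inner ℝ n (Q - P) → Q ∈ interior B)
    (h2 : ∀ᶠ Q in 𝓝 P, inner ℝ n (Q - P) < 0 → Q ∈ interior B) : False := by
  have hPW : P ∈ closure (interior Bᶜ) := by
    rw [← frontier_compl] at hP
    exact closure_minimal hW isClosed_closure hP.1
  obtain ⟨Q, ⟨h3, h4, h5⟩, hQ⟩ :=
    mem_closure_iff_nhds.1 hPW _ (hfr.and (h1.and h2))
  rcases lt_trichotomy (inner ℝ n (Q - P)) 0 with h | h | h
  · exact interior_subset hQ (interior_subset (h5 h))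
  · exact (notMem_interior_of_mem_frontier (h3.2 h)).2 hQ
  · exact interior_subset hQ (interior_subset (h4 h))

theorem exists_flat {E : Type*} [NormedAddCommGroup E] [InnerProductSpace ℝ E] {B : Set E}
    (hB : B ⊆ closure (interior B)) (hW : Bᶜ ⊆ closure (interior Bᶜ)) {P n : E}
    (hP : P ∈ frontier B) (hfr : ∀ᶠ Q in 𝓝 P, Q ∈ frontier B ↔ inner ℝ n (Q - P) = 0) :
    Flat (interior B) (interior Bᶜ) P n ∨ Flat (interior B) (interior Bᶜ) P (-n) := by
  obtain ⟨r, hr, hball⟩ := Metric.eventually_nhds_iff_ball.1 hfr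
  have hb : ∀ᶠ Q in 𝓝 P, Q ∈ Metric.ball P r := Metric.ball_mem_nhds P hr
  have hlin : IsLinearMap ℝ fun z : E => inner ℝ n z :=
    ⟨fun x y => inner_add_right _ _ _, fun c x => inner_smul_right _ _ _⟩
  have hsub : ∀ Q, inner ℝ n (Q - P) = inner ℝ n Q - inner ℝ n P := fun Q => inner_sub_right _ _ _
  have side : ∀ K : Set E, Convex ℝ K → (∀ Q ∈ K, inner ℝ n (Q - P) ≠ 0) →
      (∀ᶠ Q in 𝓝 P, Q ∈ K → Q ∈ interior B) ∨ (∀ᶠ Q in 𝓝 P, Q ∈ K → Q ∈ interior Bᶜ) := by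
    intro K hK hne
    have hd : Disjoint (Metric.ball P r ∩ K) (frontier B) :=
      Set.disjoint_left.2 fun Q hQ hQf => hne Q hQ.2 ((hball Q hQ.1).1 hQf)
    rcases subset_interior_or_of_disjoint_frontier
      ((convex_ball P r).inter hK).isPreconnected hd with h | h
    · exact .inl (hb.mono fun Q hQ hQK => h ⟨hQ, hQK⟩)
    · exact .inr (hb.mono fun Q hQ hQK => h ⟨hQ, hQK⟩)
  have sp := side {Q | 0 < inner ℝ n (Q - P)}
    (by simp only [hsub, sub_pos]; exact convex_halfSpace_gt hlin _) fun Q hQ => ne_of_gt hQ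
  have sn := side {Q | inner ℝ n (Q - P) < 0}
    (by simp only [hsub, sub_neg]; exact convex_halfSpace_lt hlin _) fun Q hQ => ne_of_lt hQ
  have hz : ∀ᶠ Q in 𝓝 P, inner ℝ n (Q - P) = 0 → Q ∉ interior B ∧ Q ∉ interior Bᶜ :=
    hfr.mono fun Q hQ h0 => notMem_interior_of_mem_frontier (hQ.2 h0)
  rcases sp with sp | sp <;> rcases sn with sn | sn
  · exact (false_of_two_sides hW hP hfr sp sn).elim
  · exact .inl (sp.and (sn.and hz))
  · refine .inr ?_
    have : Flat (interior Bᶜ) (interior B) P n :=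
      sp.and (sn.and (hz.mono fun Q hQ h0 => (hQ h0).symm))
    exact this.swap
  · refine (false_of_two_sides (B := Bᶜ) (n := n) ?_ ?_ ?_ sp sn).elim
    · rwa [compl_compl]
    · rwa [frontier_compl]
    · rwa [frontier_compl]

theorem IsPolygonal.exists_flat {B : Set Plane} {S : Set (Set Plane)} (h : IsPolygonal B S)
    {t : Set Plane} (ht : t ∈ S) {P : Plane} (hP : P ∈ t) (hv : ¬ IsVertex S P) :
    ∃ n : Plane, ‖n‖ = 1 ∧ Flat (interior B) (interior Bᶜ) P n ∧
      ∀ l : AffineSubspace ℝ Plane, IsLine l → t ⊆ l → l.direction = (ℝ ∙ n)ᗮ := by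
  obtain ⟨n, hn1, hn, hl⟩ := h.exists_normal ht hP hv
  have hPf : P ∈ frontier B := by rw [h.boundary]; exact ⟨t, ht, hP⟩
  rcases _root_.exists_flat h.black_sub h.white_sub hPf hn with hf | hf
  · exact ⟨n, hn1, hf, hl⟩
  · exact ⟨-n, by rwa [norm_neg], hf, by rwa [span_singleton_neg_eq]⟩

theorem Flat.preimage {E F : Type*} [NormedAddCommGroup E] [InnerProductSpace ℝ E]
    [NormedAddCommGroup F] [InnerProductSpace ℝ F] (M : E ≃ₗᵢ[ℝ] F) {U V : Set F} {A n : F} {p : E}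
    (h : Flat U V (A + M p) n) :
    Flat ((fun z => A + M z) ⁻¹' U) ((fun z => A + M z) ⁻¹' V) p (M.symm n) := by
  have hc : Tendsto (fun z => A + M z) (𝓝 p) (𝓝 (A + M p)) :=
    (continuous_const.add M.continuous).tendsto p
  refine (hc.eventually h).mono fun z hz => ?_
  have : inner ℝ (M.symm n) (z - p) = inner ℝ n (A + M z - (A + M p)) := by
    rw [add_sub_add_left_eq_sub, ← map_sub, ← M.inner_map_map, M.apply_symm_apply]
  rwa [this]

theorem exists_isometry {n : Plane} (hn : ‖n‖ = 1) :
    ∃ M : ℂ ≃ₗᵢ[ℝ] Plane, M Complex.I = n ∧ ∀ t v, rotVec t (M v) = M (circ t * v) := by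
  set L : ℂ ≃ₗᵢ[ℝ] Plane := Complex.orthonormalBasisOneI.repr
  have hL : ∀ t v, rotVec t (L v) = L (circ t * v) := fun t v => by
    ext i
    fin_cases i <;>
      simp [rotVec, L, Complex.orthonormalBasisOneI_repr_apply, re_circ, im_circ, add_comm]
  have hc : ‖-Complex.I * L.symm n‖ = 1 := by simp [hn]
  set c : Circle := ⟨-Complex.I * L.symm n, mem_sphere_zero_iff_norm.2 hc⟩ with hcd
  have hcv : (c : ℂ) = -Complex.I * L.symm n := rfl
  refine ⟨(rotation c).trans L, ?_, fun t v => ?_⟩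
  · rw [LinearIsometryEquiv.trans_apply, rotation_apply, hcv,
      show -Complex.I * L.symm n * Complex.I = L.symm n by
        linear_combination (-L.symm n) * Complex.I_mul_I, L.apply_symm_apply]
  · rw [LinearIsometryEquiv.trans_apply, LinearIsometryEquiv.trans_apply, hL, rotation_apply,
      rotation_apply, mul_left_comm]

theorem norm_one_sub_of_re_eq {η : ℂ} (h : ‖η‖ = 1) (hre : η.re = 1 / 2) : ‖1 - η‖ = 1 := by
  have h2 := TriangleFree.sq_add_sq_of_norm h
  have : ‖1 - η‖ ^ 2 = 1 := by
    rw [← Complex.normSq_eq_norm_sq, Complex.normSq_apply]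
    simp only [Complex.sub_re, Complex.one_re, Complex.sub_im, Complex.one_im]
    nlinarith
  exact (pow_eq_one_iff_of_nonneg (norm_nonneg _) two_ne_zero).1 this

theorem C3.triangleFree {B : Set Plane} (hB : C3 B) (A : Plane) (M : ℂ ≃ₗᵢ[ℝ] Plane) :
    TriangleFree ((fun z => A + M z) ⁻¹' interior B) ((fun z => A + M z) ⁻¹' interior Bᶜ)
      (circ (π / 3)) := by
  have hre : (circ (π / 3)).re = 1 / 2 := by rw [re_circ, Real.cos_pi_div_three]
  have hc : Continuous fun z => A + M z := continuous_const.add M.continuous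
  have hdist : ∀ z w, dist (A + M z) (A + M w) = ‖z - w‖ := fun z w => by
    rw [dist_add_left, M.dist_map, dist_eq_norm]
  have key : ∀ z u : ℂ, ‖u‖ = 1 →
      ((A + M z ∈ B ∧ A + M (z + u) ∈ B ∧ A + M (z + circ (π / 3) * u) ∈ B) ∨
        (A + M z ∉ B ∧ A + M (z + u) ∉ B ∧ A + M (z + circ (π / 3) * u) ∉ B)) →
      A + M z ∈ frontier B ∨ A + M (z + u) ∈ frontier B ∨
        A + M (z + circ (π / 3) * u) ∈ frontier B := by
    intro z u hu
    apply hB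
    · rw [hdist, sub_add_cancel_left, norm_neg, hu]
    · rw [hdist, show z + u - (z + circ (π / 3) * u) = (1 - circ (π / 3)) * u by ring, norm_mul, hu,
        norm_one_sub_of_re_eq (norm_circ _) hre, one_mul]
    · rw [hdist, add_sub_cancel_left, norm_mul, norm_circ, hu, one_mul]
  refine ⟨isOpen_interior.preimage hc, isOpen_interior.preimage hc,
    (disjoint_compl_right.mono interior_subset interior_subset).preimage _,
    norm_circ _, hre, fun z u hu h1 h2 h3 => ?_, fun z u hu h1 h2 h3 => ?_⟩
  · rcases key z u hu (.inl ⟨interior_subset h1, interior_subset h2, interior_subset h3⟩)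
      with h | h | h
    · exact (notMem_interior_of_mem_frontier h).1 h1
    · exact (notMem_interior_of_mem_frontier h).1 h2
    · exact (notMem_interior_of_mem_frontier h).1 h3
  · rcases key z u hu (.inr ⟨interior_subset h1, interior_subset h2, interior_subset h3⟩)
      with h | h | h
    · exact (notMem_interior_of_mem_frontier h).2 h1
    · exact (notMem_interior_of_mem_frontier h).2 h2
    · exact (notMem_interior_of_mem_frontier h).2 h3

theorem mem_frontier_iff_notMem_interior_and {X : Type*} [TopologicalSpace X] {B : Set X} {x : X} :
    x ∈ frontier B ↔ x ∉ interior B ∧ x ∉ interior Bᶜ := by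
  rw [interior_compl, Set.mem_compl_iff, not_not, and_comm]
  rfl

theorem isPrimitiveRoot_circ : IsPrimitiveRoot (circ (π / 3)) 6 := by
  convert Complex.isPrimitiveRoot_exp 6 (by norm_num) using 1
  unfold circ
  congr 1
  push_cast
  ring

theorem exists_fin_six (k : ℤ) :
    ∃ i : Fin 6, circ (k * (π / 3)) = circ (((i : ℕ) : ℝ) * (π / 3)) := by
  refine ⟨⟨(k % 6).toNat, by omega⟩, ?_⟩
  have h6 : circ (π / 3) ^ (6 : ℤ) = 1 := by exact_mod_cast isPrimitiveRoot_circ.pow_eq_one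
  have hcast : (((k % 6).toNat : ℕ) : ℝ) = ((k % 6 : ℤ) : ℝ) := by
    exact_mod_cast Int.toNat_of_nonneg (Int.emod_nonneg k (by norm_num))
  have hne : circ (π / 3) ≠ 0 := Complex.exp_ne_zero _
  show _ = circ (((k % 6).toNat : ℕ) * (π / 3))
  rw [hcast, circ_int_mul, circ_int_mul]
  conv_lhs => rw [← Int.mul_ediv_add_emod k 6, zpow_add₀ hne, zpow_mul, h6, one_zpow, one_mul]

theorem circ_fin_six_injective :
    Function.Injective fun i : Fin 6 => circ (((i : ℕ) : ℝ) * (π / 3)) := by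
  intro i j hij
  have h := fun i : Fin 6 => circ_int_mul (i : ℕ) (π / 3)
  simp only [Int.cast_natCast, zpow_natCast] at h
  simp only [h] at hij
  exact Fin.ext (isPrimitiveRoot_circ.pow_inj i.2 j.2 hij)

end Local

theorem stmt16 (B : Set (EuclideanSpace ℝ (Fin 2))) (S : Set (Set (EuclideanSpace ℝ (Fin 2))))
    (hpoly : IsPolygonal B S) (hC3 : C3 B)
    (A : EuclideanSpace ℝ (Fin 2)) (hA : Feasible B S A)
    (s : Set (EuclideanSpace ℝ (Fin 2))) (hs : s ∈ S) (hAs : A ∈ s) :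
    (frontier B ∩ Metric.sphere A 1).ncard = 6 ∧
    ∃ u : EuclideanSpace ℝ (Fin 2), ‖u‖ = 1 ∧
      frontier B ∩ Metric.sphere A 1 =
        {P : EuclideanSpace ℝ (Fin 2) | ∃ i : Fin 6, P = A + rotVec (((i : ℕ) : ℝ) * (π / 3)) u} ∧
      ∀ P ∈ frontier B ∩ Metric.sphere A 1, ∃ t ∈ S, P ∈ t ∧ SegParallel s t := by
  obtain ⟨n, hn, hflat, hdir⟩ := hpoly.exists_flat hs hAs hA.2.1
  obtain ⟨M, hMI, hMrot⟩ := exists_isometry hn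
  have hsphere : ∀ w, A + M w ∈ Metric.sphere A 1 ↔ ‖w‖ = 1 := fun w => by
    rw [mem_sphere_iff_norm, add_sub_cancel_left, M.norm_map]
  have hlocal : ∀ w, ‖w‖ = 1 → A + M w ∈ frontier B → ∃ t ∈ S, A + M w ∈ t ∧ ∃ m, ‖m‖ = 1 ∧
      Flat ((fun z => A + M z) ⁻¹' interior B) ((fun z => A + M z) ⁻¹' interior Bᶜ) w m ∧
      ∀ l : AffineSubspace ℝ (EuclideanSpace ℝ (Fin 2)), IsLine l → t ⊆ l →
        l.direction = (ℝ ∙ M m)ᗮ := by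
    intro w hw hfr
    obtain ⟨t, ht, hwt⟩ := hpoly.boundary ▸ hfr
    obtain ⟨m, hm, hmflat, hmdir⟩ :=
      hpoly.exists_flat ht hwt (hA.2.2 _ ((hsphere w).2 hw))
    exact ⟨t, ht, hwt, M.symm m, by rwa [M.symm.norm_map], hmflat.preimage M,
      by rwa [M.apply_symm_apply]⟩
  have hcircle : TriangleFree.CircleFlat ((fun z => A + M z) ⁻¹' interior B)
      ((fun z => A + M z) ⁻¹' interior Bᶜ) := by
    intro w hw
    by_cases hfr : A + M w ∈ frontier B
    · obtain ⟨t, -, -, m, hm, hmflat, -⟩ := hlocal w hw hfr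
      exact .inr (.inr ⟨m, hm, hmflat⟩)
    · rw [mem_frontier_iff_notMem_interior_and, not_and_or, not_not, not_not] at hfr
      exact hfr.elim .inl fun h => .inr (.inl h)
  have hzero : Flat ((fun z => A + M z) ⁻¹' interior B) ((fun z => A + M z) ⁻¹' interior Bᶜ) 0
      Complex.I := by
    rw [← M.symm_apply_eq.2 hMI.symm]
    apply Flat.preimage
    rwa [map_zero, add_zero]
  obtain ⟨u, hu, hhex, hpar⟩ := hexagon (hC3.triangleFree A M) hcircle hzero
  have hset : frontier B ∩ Metric.sphere A 1 =
      {P | ∃ i : Fin 6, P = A + rotVec (((i : ℕ) : ℝ) * (π / 3)) (M u)} := by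
    ext P
    obtain ⟨w, rfl⟩ : ∃ w, A + M w = P := ⟨M.symm (P - A), by simp⟩
    simp only [Set.mem_inter_iff, hsphere, mem_frontier_iff_notMem_interior_and, Set.mem_ofPred_eq,
      hMrot, add_right_inj, M.injective.eq_iff]
    constructor
    · rintro ⟨hfr, hw⟩
      obtain ⟨k, rfl⟩ := (hhex w hw).1 hfr
      obtain ⟨i, hi⟩ := exists_fin_six k
      exact ⟨i, by rw [hi]⟩
    · rintro ⟨i, rfl⟩
      have hw : ‖circ (((i : ℕ) : ℝ) * (π / 3)) * u‖ = 1 := by rw [norm_mul, norm_circ, hu, one_mul]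
      exact ⟨(hhex _ hw).2 ⟨(i : ℕ), by rw [Int.cast_natCast]⟩, hw⟩
  have hu0 : u ≠ 0 := fun h => by simp [h] at hu
  refine ⟨?_, M u, by rwa [M.norm_map], hset, ?_⟩
  · have hinj : Function.Injective fun i : Fin 6 => A + rotVec (((i : ℕ) : ℝ) * (π / 3)) (M u) := by
      intro i j hij
      simp only [hMrot, add_right_inj, M.injective.eq_iff] at hij
      exact circ_fin_six_injective (mul_right_cancel₀ hu0 hij)
    rw [hset]
    convert Set.ncard_range_of_injective hinj using 1
    · congr 1
      ext P
      simp [eq_comm]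
    · simp
  · rintro P ⟨hfr, hP⟩
    obtain ⟨w, rfl⟩ : ∃ w, A + M w = P := ⟨M.symm (P - A), by simp⟩
    have hw := (hsphere w).1 hP
    obtain ⟨t, ht, hwt, m, hm, hmflat, hmdir⟩ := hlocal w hw hfr
    refine ⟨t, ht, hwt, fun l₁ l₂ h₁ h₂ hsl htl => ?_⟩
    rw [hdir l₁ h₁ hsl, hmdir l₂ h₂ htl]
    rcases TriangleFree.eq_I_or_eq_neg_I hm (hpar w m hw hm hmflat) with rfl | rfl
    · rw [hMI]
    · rw [map_neg, span_singleton_neg_eq, hMI]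

end
end

section
/- Let (B,W) be a polygonal coloring of the plane with boundary ∂ satisfying condition (C3). Then no point of the plane is a common endpoint of three pairwise distinct boundary segments. -/
open scoped RealInnerProductSpace

noncomputable section

/-- The Euclidean plane. -/
abbrev Plane := EuclideanSpace ℝ (Fin 2)

namespace Plane

/-- Rotation by a right angle. -/
def quarterTurn (v : Plane) : Plane := !₂[-v 1, v 0]

/-- Rotation by sixty degrees. -/
def sixthTurn (v : Plane) : Plane :=
  !₂[v 0 / 2 - √3 / 2 * v 1, √3 / 2 * v 0 + v 1 / 2]

theorem inner_eq (u v : Plane) : ⟪u, v⟫ = u 0 * v 0 + u 1 * v 1 := by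
  simp [PiLp.inner_apply, Fin.sum_univ_two]
  ring

theorem norm_sq_eq (v : Plane) : ‖v‖ ^ 2 = v 0 ^ 2 + v 1 ^ 2 := by
  rw [← real_inner_self_eq_norm_sq, inner_eq]
  ring

theorem norm_eq_one_iff (v : Plane) : ‖v‖ = 1 ↔ v 0 ^ 2 + v 1 ^ 2 = 1 := by
  rw [← norm_sq_eq, pow_eq_one_iff_of_nonneg (norm_nonneg v) two_ne_zero]

theorem norm_sq_pos {v : Plane} (hv : v ≠ 0) : 0 < v 0 ^ 2 + v 1 ^ 2 := by
  rw [← norm_sq_eq]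
  positivity

theorem ext_coord {u v : Plane} (h0 : u 0 = v 0) (h1 : u 1 = v 1) : u = v := by
  ext i
  fin_cases i
  · exact h0
  · exact h1

@[simp] theorem quarterTurn_zero (v : Plane) : quarterTurn v 0 = -v 1 := rfl

@[simp] theorem quarterTurn_one (v : Plane) : quarterTurn v 1 = v 0 := rfl

@[simp] theorem sixthTurn_zero (v : Plane) :
    sixthTurn v 0 = v 0 / 2 - √3 / 2 * v 1 := rfl

@[simp] theorem sixthTurn_one (v : Plane) :
    sixthTurn v 1 = √3 / 2 * v 0 + v 1 / 2 := rfl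

theorem quarterTurn_ne_zero {v : Plane} (hv : v ≠ 0) : quarterTurn v ≠ 0 := by
  intro h
  apply hv
  have h0 := congrArg (fun w : Plane => w 0) h
  have h1 := congrArg (fun w : Plane => w 1) h
  simp at h0 h1
  exact ext_coord (by simpa using h1) (by simpa using h0)

theorem inner_quarterTurn_self (v : Plane) : ⟪quarterTurn v, v⟫ = 0 := by
  rw [inner_eq]
  simp
  ring

theorem continuous_sixthTurn : Continuous sixthTurn := by
  unfold sixthTurn
  fun_prop

theorem norm_sixthTurn {v : Plane} (hv : ‖v‖ = 1) : ‖sixthTurn v‖ = 1 := by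
  rw [norm_eq_one_iff] at *
  have h3 : √3 ^ 2 = (3 : ℝ) := Real.sq_sqrt (by norm_num)
  simp only [sixthTurn_zero, sixthTurn_one]
  linear_combination (v 0 ^ 2 + v 1 ^ 2) / 4 * h3 + hv

theorem norm_sixthTurn_sub {v : Plane} (hv : ‖v‖ = 1) : ‖sixthTurn v - v‖ = 1 := by
  rw [norm_eq_one_iff] at *
  have h3 : √3 ^ 2 = (3 : ℝ) := Real.sq_sqrt (by norm_num)
  simp only [PiLp.sub_apply, sixthTurn_zero, sixthTurn_one]
  linear_combination (v 0 ^ 2 + v 1 ^ 2) / 4 * h3 + hv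

theorem sixthTurn_sixthTurn_sixthTurn (v : Plane) :
    sixthTurn (sixthTurn (sixthTurn v)) = -v := by
  have h3 : √3 ^ 2 = (3 : ℝ) := Real.sq_sqrt (by norm_num)
  apply ext_coord
  · simp only [PiLp.neg_apply, sixthTurn_zero, sixthTurn_one]
    linear_combination (-3 / 8 * v 0 + √3 / 8 * v 1) * h3
  · simp only [PiLp.neg_apply, sixthTurn_zero, sixthTurn_one]
    linear_combination (-3 / 8 * v 1 - √3 / 8 * v 0) * h3

theorem sixthTurn_neg (v : Plane) : sixthTurn (-v) = -sixthTurn v := by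
  apply ext_coord <;> simp <;> ring

/-- In the plane, vectors orthogonal to a common nonzero vector are parallel. -/
theorem exists_eq_smul {n a b : Plane} (hn : n ≠ 0) (hb : b ≠ 0)
    (hna : ⟪n, a⟫ = 0) (hnb : ⟪n, b⟫ = 0) : ∃ c : ℝ, a = c • b := by
  rw [inner_eq] at hna hnb
  have hn' := norm_sq_pos hn
  have hb' := norm_sq_pos hb
  have hdet : a 0 * b 1 - a 1 * b 0 = 0 := by
    have h : (n 0 ^ 2 + n 1 ^ 2) * (a 0 * b 1 - a 1 * b 0) = 0 := by
      linear_combination (n 0 * b 1 - n 1 * b 0) * hna + (n 1 * a 0 - n 0 * a 1) * hnb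
    exact (mul_eq_zero.mp h).resolve_left hn'.ne'
  refine ⟨(a 0 * b 0 + a 1 * b 1) / (b 0 ^ 2 + b 1 ^ 2), ext_coord ?_ ?_⟩
  · simp only [PiLp.smul_apply, smul_eq_mul]
    field_simp
    linear_combination b 1 * hdet
  · simp only [PiLp.smul_apply, smul_eq_mul]
    field_simp
    linear_combination -b 0 * hdet

/-- A line meets the unit circle in finitely many points. -/
theorem finite_unit_inner_eq {w : Plane} (hw : w ≠ 0) (γ : ℝ) :
    {u : Plane | ‖u‖ = 1 ∧ ⟪w, u⟫ = γ}.Finite := by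
  have hw' := norm_sq_pos hw
  set K := w 0 ^ 2 + w 1 ^ 2 - γ ^ 2 with hK
  refine ((Set.toFinite {√K, -√K}).image
    fun t : ℝ => (w 0 ^ 2 + w 1 ^ 2)⁻¹ • (γ • w + t • quarterTurn w)).subset ?_
  rintro u ⟨hu, huγ⟩
  rw [norm_eq_one_iff] at hu
  rw [inner_eq] at huγ
  refine ⟨⟪quarterTurn w, u⟫, ?_, ?_⟩
  · have hsq : ⟪quarterTurn w, u⟫ ^ 2 = K := by
      rw [inner_eq, hK, ← huγ]
      simp only [quarterTurn_zero, quarterTurn_one]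
      linear_combination (w 0 ^ 2 + w 1 ^ 2) * hu
    have hsqrt : √K ^ 2 = K := Real.sq_sqrt (hsq ▸ sq_nonneg _)
    rw [← hsqrt] at hsq
    exact sq_eq_sq_iff_eq_or_eq_neg.mp hsq
  · apply ext_coord
    · simp only [inner_eq, PiLp.smul_apply, PiLp.add_apply, smul_eq_mul, quarterTurn_zero,
        quarterTurn_one, ← huγ]
      field_simp
      ring
    · simp only [inner_eq, PiLp.smul_apply, PiLp.add_apply, smul_eq_mul, quarterTurn_zero,
        quarterTurn_one, ← huγ]
      field_simp
      ring

/-- The rotated copy of `u` by the angle `τ`. -/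
def turn (u : Plane) (τ : ℝ) : Plane := Real.cos τ • u + Real.sin τ • quarterTurn u

theorem turn_zero (u : Plane) : turn u 0 = u := by simp [turn]

theorem continuous_turn (u : Plane) : Continuous (turn u) := by
  unfold turn
  fun_prop

theorem norm_turn {u : Plane} (hu : ‖u‖ = 1) (τ : ℝ) : ‖turn u τ‖ = 1 := by
  rw [norm_eq_one_iff] at *
  simp only [turn, PiLp.smul_apply, PiLp.add_apply, smul_eq_mul, quarterTurn_zero,
    quarterTurn_one]
  linear_combination (Real.cos τ ^ 2 + Real.sin τ ^ 2) * hu + Real.sin_sq_add_cos_sq τ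

theorem tendsto_turn (u : Plane) : Filter.Tendsto (turn u) (nhds 0) (nhds u) := by
  simpa [turn_zero] using (continuous_turn u).tendsto 0

/-- The unit circle crosses every line through `u` that is not tangent to it at `u`. -/
theorem frequently_inner_lt_inner_turn {u n : Plane} (hn : ⟪n, quarterTurn u⟫ ≠ 0) :
    ∃ᶠ τ in nhds (0 : ℝ), ⟪n, u⟫ < ⟪n, turn u τ⟫ := by
  intro h
  have hmax : IsLocalMax (fun τ => ⟪n, turn u τ⟫) 0 := by
    filter_upwards [h] with τ hτ
    rw [turn_zero]
    exact not_lt.mp hτ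
  have hd : HasDerivAt (fun τ => ⟪n, turn u τ⟫) ⟪n, quarterTurn u⟫ 0 := by
    have h1 := ((Real.hasDerivAt_cos 0).mul_const ⟪n, u⟫).add
      ((Real.hasDerivAt_sin 0).mul_const ⟪n, quarterTurn u⟫)
    simp only [Real.sin_zero, neg_zero, zero_mul, Real.cos_zero, one_mul, zero_add] at h1
    refine h1.congr_of_eventuallyEq (Filter.Eventually.of_forall fun τ => ?_)
    simp [turn, inner_add_right, inner_smul_right]
  exact hn (hmax.hasDerivAt_eq_zero hd)

/-- A set of unit vectors missing only finitely many unit vectors is dense in the circle. -/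
theorem mem_closure_unit_diff {K : Set Plane} (hK : K.Finite) {u : Plane} (hu : ‖u‖ = 1) :
    u ∈ closure {v : Plane | ‖v‖ = 1 ∧ v ∉ K} := by
  rw [mem_closure_iff_frequently]
  have hsin : ∀ᶠ τ in nhdsWithin (0 : ℝ) (Set.Ioi 0), turn u τ ∉ K := by
    have hK' : (K \ {u})ᶜ ∈ nhds u :=
      (hK.subset Set.sdiff_subset).isClosed.isOpen_compl.mem_nhds (by simp)
    have h1 : ∀ᶠ τ in nhdsWithin (0 : ℝ) (Set.Ioi 0), turn u τ ∈ (K \ {u})ᶜ :=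
      ((tendsto_turn u).mono_left nhdsWithin_le_nhds) hK'
    have h2 : ∀ᶠ τ in nhdsWithin (0 : ℝ) (Set.Ioi 0), τ < Real.pi :=
      nhdsWithin_le_nhds (gt_mem_nhds Real.pi_pos)
    filter_upwards [h1, h2, self_mem_nhdsWithin] with τ h1 h2 h3 hτ
    refine h1 ⟨hτ, fun heq => ?_⟩
    have hs : ⟪quarterTurn u, turn u τ⟫ = Real.sin τ := by
      rw [norm_eq_one_iff] at hu
      simp only [turn, inner_eq, PiLp.smul_apply, PiLp.add_apply, smul_eq_mul,
        quarterTurn_zero, quarterTurn_one]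
      linear_combination Real.sin τ * hu
    rw [Set.mem_singleton_iff.mp heq, inner_quarterTurn_self] at hs
    exact (Real.sin_pos_of_pos_of_lt_pi h3 h2).ne hs
  have hfreq : ∃ᶠ τ in nhdsWithin (0 : ℝ) (Set.Ioi 0), ‖turn u τ‖ = 1 ∧ turn u τ ∉ K :=
    (hsin.mono fun τ hτ => ⟨norm_turn hu τ, hτ⟩).frequently
  exact ((tendsto_turn u).mono_left nhdsWithin_le_nhds).frequently hfreq

/-- Every unit vector has arbitrarily small connected neighbourhoods in the unit circle. -/
theorem exists_isPreconnected_arc {e : Plane} (he : ‖e‖ = 1) {U : Set Plane}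
    (hU : U ∈ nhds e) :
    ∃ Z V : Set Plane, IsPreconnected Z ∧ Z ⊆ U ∧ (∀ v ∈ Z, ‖v‖ = 1) ∧ V ∈ nhds e ∧
      ∀ v ∈ V, ‖v‖ = 1 → v ∈ Z := by
  have he0 : ‖e‖ ≠ 0 := by simp [he]
  have hcont : ContinuousAt (fun v : Plane => ‖v‖⁻¹ • v) e :=
    (continuous_norm.continuousAt.inv₀ he0).smul continuousAt_id
  have hpre : (fun v : Plane => ‖v‖⁻¹ • v) ⁻¹' U ∈ nhds e := by
    apply hcont
    simpa [he] using hU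
  obtain ⟨ε, hε, hsub⟩ := Metric.mem_nhds_iff.mp
    (Filter.inter_mem hpre ((isOpen_ne (x := (0 : Plane))).mem_nhds (norm_ne_zero_iff.mp he0)))
  refine ⟨(fun v : Plane => ‖v‖⁻¹ • v) '' Metric.ball e ε, Metric.ball e ε, ?_, ?_, ?_,
    Metric.ball_mem_nhds e hε, ?_⟩
  · refine (convex_ball e ε).isPreconnected.image _ fun v hv => ?_
    exact ((continuous_norm.continuousAt.inv₀
      (norm_ne_zero_iff.mpr (hsub hv).2)).smul continuousAt_id).continuousWithinAt
  · rintro _ ⟨v, hv, rfl⟩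
    exact (hsub hv).1
  · rintro _ ⟨v, hv, rfl⟩
    have : ‖v‖ ≠ 0 := norm_ne_zero_iff.mpr (hsub hv).2
    simp [norm_smul, this]
  · intro v hv h1
    exact ⟨v, hv, by simp [h1]⟩

end Plane

open Plane

/-- Two open colour classes `G` and `H` separated by a locally finite family `S` of boundary
segments, with no unit equilateral triangle inside one class. -/
structure SeparatedColoring (G H : Set Plane) (S : Set (Set Plane)) : Prop where
  isOpen_left : IsOpen G
  isOpen_right : IsOpen H
  disjoint : Disjoint G H
  compl_union : (G ∪ H)ᶜ = ⋃₀ S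
  sub_closure_left : ⋃₀ S ⊆ closure G
  sub_closure_right : ⋃₀ S ⊆ closure H
  isClosed : ∀ s ∈ S, IsClosed s
  convex : ∀ s ∈ S, Convex ℝ s
  exists_normal : ∀ s ∈ S, ∃ n : Plane, n ≠ 0 ∧ ∀ x ∈ s, ∀ y ∈ s, ⟪n, x - y⟫ = 0
  inter_subsingleton : ∀ s ∈ S, ∀ t ∈ S, s ≠ t → (s ∩ t).Subsingleton
  loc_finite : ∀ R : Set Plane, Bornology.IsBounded R → {s ∈ S | (s ∩ R).Nonempty}.Finite
  no_triangle_left : ∀ A u : Plane, ‖u‖ = 1 → A ∈ G → A + u ∈ G → A + sixthTurn u ∉ G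
  no_triangle_right : ∀ A u : Plane, ‖u‖ = 1 → A ∈ H → A + u ∈ H → A + sixthTurn u ∉ H

/-- The unit vectors `v` such that `A + v` lies in `G`. -/
def unitArc (G : Set Plane) (A : Plane) : Set Plane := {v | ‖v‖ = 1 ∧ A + v ∈ G}

/-- The unit vectors at which the circle around `A` passes from `G` to `H`. -/
def changes (G H : Set Plane) (A : Plane) : Set Plane :=
  closure (unitArc G A) ∩ closure (unitArc H A)

theorem norm_of_mem_closure_unitArc {G : Set Plane} {A v : Plane}
    (hv : v ∈ closure (unitArc G A)) : ‖v‖ = 1 :=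
  closure_minimal (t := {v : Plane | ‖v‖ = 1}) (fun _ h => h.1)
    (isClosed_eq continuous_norm continuous_const) hv

namespace SeparatedColoring

variable {G H : Set Plane} {S : Set (Set Plane)}

theorem symm (h : SeparatedColoring G H S) : SeparatedColoring H G S where
  isOpen_left := h.isOpen_right
  isOpen_right := h.isOpen_left
  disjoint := h.disjoint.symm
  compl_union := by rw [Set.union_comm]; exact h.compl_union
  sub_closure_left := h.sub_closure_right
  sub_closure_right := h.sub_closure_left
  isClosed := h.isClosed
  convex := h.convex
  exists_normal := h.exists_normal
  inter_subsingleton := h.inter_subsingleton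
  loc_finite := h.loc_finite
  no_triangle_left := h.no_triangle_right
  no_triangle_right := h.no_triangle_left

theorem mem_sUnion_iff (h : SeparatedColoring G H S) {x : Plane} :
    x ∈ ⋃₀ S ↔ x ∉ G ∧ x ∉ H := by
  rw [← h.compl_union]
  simp

theorem finite_unit_boundary (h : SeparatedColoring G H S) (A : Plane) :
    {v : Plane | ‖v‖ = 1 ∧ A + v ∈ ⋃₀ S}.Finite := by
  refine ((h.loc_finite (Metric.closedBall A 1) Metric.isBounded_closedBall).biUnion
    (t := fun s => {v : Plane | ‖v‖ = 1 ∧ A + v ∈ s}) ?_).subset ?_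
  · rintro s ⟨hs, x, hx, -⟩
    obtain ⟨n, hn, hns⟩ := h.exists_normal s hs
    refine (finite_unit_inner_eq hn ⟪n, x - A⟫).subset ?_
    rintro v ⟨hv, hvs⟩
    refine ⟨hv, ?_⟩
    have := hns _ hvs _ hx
    simp only [inner_add_right, inner_sub_right] at this ⊢
    linarith
  · rintro v ⟨hv, s, hs, hvs⟩
    exact Set.mem_biUnion (show s ∈ {s ∈ S | (s ∩ Metric.closedBall A 1).Nonempty} from
      ⟨hs, A + v, hvs, by simp [hv]⟩) ⟨hv, hvs⟩

theorem mem_closure_or (h : SeparatedColoring G H S) (A : Plane) {v : Plane} (hv : ‖v‖ = 1) :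
    v ∈ closure (unitArc G A) ∪ closure (unitArc H A) := by
  rw [← closure_union]
  refine closure_mono ?_ (mem_closure_unit_diff (h.finite_unit_boundary A) hv)
  rintro w ⟨hw, hwS⟩
  have : ¬(A + w ∉ G ∧ A + w ∉ H) := fun hc => hwS ⟨hw, h.mem_sUnion_iff.mpr hc⟩
  by_cases hG : A + w ∈ G
  · exact Or.inl ⟨hw, hG⟩
  · exact Or.inr ⟨hw, by tauto⟩

theorem add_mem_of_mem_changes (h : SeparatedColoring G H S) {A v : Plane}
    (hv : v ∈ changes G H A) : A + v ∈ ⋃₀ S := by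
  have key : ∀ {G H : Set Plane}, SeparatedColoring G H S →
      v ∈ closure (unitArc H A) → A + v ∉ G := by
    intro G H h hv hG
    obtain ⟨w, hw1, hw2⟩ := mem_closure_iff_nhds.mp hv ((fun w => A + w) ⁻¹' G)
      ((h.isOpen_left.preimage (continuous_const.add continuous_id)).mem_nhds hG)
    exact Set.disjoint_left.mp h.disjoint hw1 hw2.2
  exact h.mem_sUnion_iff.mpr ⟨key h hv.2, key h.symm hv.1⟩

/-- A connected part of the unit circle meeting both colour classes contains a change. -/
theorem exists_mem_changes (h : SeparatedColoring G H S) {A : Plane} {Z : Set Plane}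
    (hZ : IsPreconnected Z) (hZ1 : ∀ v ∈ Z, ‖v‖ = 1)
    (hG : (Z ∩ closure (unitArc G A)).Nonempty) (hH : (Z ∩ closure (unitArc H A)).Nonempty) :
    ∃ u ∈ Z, u ∈ changes G H A :=
  isPreconnected_closed_iff.mp hZ _ _ isClosed_closure isClosed_closure
    (fun v hv => h.mem_closure_or A (hZ1 v hv)) hG hH

theorem eventually_exists_mem_changes (h : SeparatedColoring G H S) {X e : Plane}
    (he : e ∈ changes G H X) {U : Set Plane} (hU : U ∈ nhds e) :
    ∀ᶠ A in nhds X, ∃ u ∈ U, u ∈ changes G H A := by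
  obtain ⟨Z, V, hZ, hZU, hZ1, hV, hVZ⟩ :=
    exists_isPreconnected_arc (norm_of_mem_closure_unitArc he.1) hU
  obtain ⟨v, hvV, hv1, hvG⟩ := mem_closure_iff_nhds.mp he.1 V hV
  obtain ⟨w, hwV, hw1, hwH⟩ := mem_closure_iff_nhds.mp he.2 V hV
  have hv : ∀ᶠ A in nhds X, A + v ∈ G :=
    (h.isOpen_left.preimage (continuous_id.add continuous_const)).mem_nhds hvG
  have hw : ∀ᶠ A in nhds X, A + w ∈ H :=
    (h.isOpen_right.preimage (continuous_id.add continuous_const)).mem_nhds hwH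
  filter_upwards [hv, hw] with A hvA hwA
  obtain ⟨u, huZ, hu⟩ := h.exists_mem_changes (A := A) hZ hZ1
    ⟨v, hVZ v hvV hv1, subset_closure ⟨hv1, hvA⟩⟩ ⟨w, hVZ w hwV hw1, subset_closure ⟨hw1, hwA⟩⟩
  exact ⟨u, hZU huZ, hu⟩

theorem sixthTurn_notMem_unitArc (h : SeparatedColoring G H S) {A v : Plane} (hA : A ∈ ⋃₀ S)
    (hv : v ∈ unitArc G A) : sixthTurn v ∉ unitArc G A := by
  intro hv'
  have hnhds : (fun x => x + v) ⁻¹' G ∩ (fun x => x + sixthTurn v) ⁻¹' G ∈ nhds A :=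
    Filter.inter_mem
      ((h.isOpen_left.preimage (continuous_id.add continuous_const)).mem_nhds hv.2)
      ((h.isOpen_left.preimage (continuous_id.add continuous_const)).mem_nhds hv'.2)
  obtain ⟨x, hx, hxG⟩ := mem_closure_iff_nhds.mp (h.sub_closure_left hA) _ hnhds
  exact h.no_triangle_left x v hv.1 hxG hx.1 hx.2

theorem sixthTurn_mem_closure (h : SeparatedColoring G H S) {A v : Plane} (hA : A ∈ ⋃₀ S)
    (hv : v ∈ closure (unitArc G A)) : sixthTurn v ∈ closure (unitArc H A) := by
  suffices hsub : sixthTurn '' unitArc G A ⊆ closure (unitArc H A) from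
    closure_minimal hsub isClosed_closure
      (image_closure_subset_closure_image continuous_sixthTurn ⟨v, hv, rfl⟩)
  rintro _ ⟨v, hv, rfl⟩
  refine (h.mem_closure_or A (norm_sixthTurn hv.1)).resolve_left fun hc => ?_
  have hcont : Continuous fun y => A + -sixthTurn (sixthTurn y) :=
    continuous_const.add (continuous_sixthTurn.comp continuous_sixthTurn).neg
  have hmem : (fun y => A + -sixthTurn (sixthTurn y)) ⁻¹' G ∈ nhds (sixthTurn v) := by
    refine (h.isOpen_left.preimage hcont).mem_nhds ?_
    simpa [sixthTurn_sixthTurn_sixthTurn] using hv.2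
  obtain ⟨y, hy, hyG⟩ := mem_closure_iff_nhds.mp hc _ hmem
  have hz : -sixthTurn (sixthTurn y) ∈ unitArc G A :=
    ⟨by rw [norm_neg]; exact norm_sixthTurn (norm_sixthTurn hyG.1), hy⟩
  apply h.sixthTurn_notMem_unitArc hA hz
  rwa [sixthTurn_neg, sixthTurn_sixthTurn_sixthTurn, neg_neg]

theorem neg_mem_changes (h : SeparatedColoring G H S) {A v : Plane} (hA : A ∈ ⋃₀ S)
    (hv : v ∈ changes G H A) : -v ∈ changes G H A := by
  rw [← sixthTurn_sixthTurn_sixthTurn]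
  exact ⟨h.symm.sixthTurn_mem_closure hA (h.sixthTurn_mem_closure hA
      (h.symm.sixthTurn_mem_closure hA hv.2)),
    h.sixthTurn_mem_closure hA (h.symm.sixthTurn_mem_closure hA
      (h.sixthTurn_mem_closure hA hv.1))⟩

theorem nonempty_changes (h : SeparatedColoring G H S) {A : Plane} (hA : A ∈ ⋃₀ S) :
    (changes G H A).Nonempty := by
  have hsphere : IsPreconnected (Metric.sphere (0 : Plane) 1) :=
    isPreconnected_sphere (by rw [← Module.finrank_eq_rank]; simp) 0 1
  obtain ⟨v, hv⟩ := NormedSpace.sphere_nonempty (x := (0 : Plane)) (r := 1) |>.mpr zero_le_one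
  have hmem : ∀ {w : Plane}, ‖w‖ = 1 → w ∈ Metric.sphere (0 : Plane) 1 := by simp
  have hv1 : ‖v‖ = 1 := by simpa using hv
  have hw1 := norm_sixthTurn hv1
  have : ∃ u ∈ Metric.sphere (0 : Plane) 1, u ∈ changes G H A := by
    apply h.exists_mem_changes hsphere (fun v hv => by simpa using hv)
    · rcases h.mem_closure_or A hv1 with hc | hc
      · exact ⟨v, hv, hc⟩
      · exact ⟨_, hmem hw1, h.symm.sixthTurn_mem_closure hA hc⟩
    · rcases h.mem_closure_or A hv1 with hc | hc
      · exact ⟨_, hmem hw1, h.sixthTurn_mem_closure hA hc⟩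
      · exact ⟨v, hv, hc⟩
  obtain ⟨u, -, hu⟩ := this
  exact ⟨u, hu⟩

/-- Near a given point, only the segments through that point are visible. -/
theorem exists_ball_forall_mem (h : SeparatedColoring G H S) (P : Plane) :
    ∃ ρ > 0, ∀ s ∈ S, (s ∩ Metric.ball P ρ).Nonempty → P ∈ s := by
  have hfin : {s ∈ S | (s ∩ Metric.ball P 1).Nonempty ∧ P ∉ s}.Finite :=
    (h.loc_finite _ Metric.isBounded_ball).subset fun s hs => ⟨hs.1, hs.2.1⟩
  have hopen : (⋃ s ∈ {s ∈ S | (s ∩ Metric.ball P 1).Nonempty ∧ P ∉ s}, s)ᶜ ∈ nhds P := by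
    refine (hfin.isClosed_biUnion fun s hs => h.isClosed s hs.1).isOpen_compl.mem_nhds ?_
    simp only [Set.mem_compl_iff, Set.mem_iUnion, not_exists]
    intro s hs
    exact hs.2.2
  obtain ⟨ρ, hρ, hsub⟩ := Metric.mem_nhds_iff.mp
    (Filter.inter_mem hopen (Metric.ball_mem_nhds P one_pos))
  refine ⟨ρ, hρ, ?_⟩
  rintro s hs ⟨y, hys, hyρ⟩
  by_contra hP
  exact (hsub hyρ).1 (Set.mem_biUnion
    (show s ∈ {s ∈ S | (s ∩ Metric.ball P 1).Nonempty ∧ P ∉ s} from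
      ⟨hs, ⟨y, hys, (hsub hyρ).2⟩, hP⟩) hys)

theorem subset_or_subset (h : SeparatedColoring G H S) {C : Set Plane} (hC : Convex ℝ C)
    (hCS : Disjoint C (⋃₀ S)) : C ⊆ G ∨ C ⊆ H := by
  refine hC.isPreconnected.subset_or_subset h.isOpen_left h.isOpen_right h.disjoint fun x hx => ?_
  have := Set.disjoint_left.mp hCS hx
  rw [h.mem_sUnion_iff] at this
  simp only [Set.mem_union]
  tauto

/-- Near a point of exactly one boundary segment, the segment separates the two colours. -/
theorem exists_half_disks (h : SeparatedColoring G H S) {s : Set Plane} (hs : s ∈ S)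
    {Q : Plane} (hQ : Q ∈ s) (hQs : ∀ t ∈ S, Q ∈ t → t = s) {n : Plane} (hn : n ≠ 0)
    (hns : ∀ x ∈ s, ⟪n, x - Q⟫ = 0) :
    ∃ ε > 0,
      ((∀ y ∈ Metric.ball Q ε, 0 < ⟪n, y - Q⟫ → y ∈ G) ∧
        (∀ y ∈ Metric.ball Q ε, ⟪n, y - Q⟫ < 0 → y ∈ H)) ∨
      ((∀ y ∈ Metric.ball Q ε, 0 < ⟪n, y - Q⟫ → y ∈ H) ∧
        (∀ y ∈ Metric.ball Q ε, ⟪n, y - Q⟫ < 0 → y ∈ G)) := by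
  obtain ⟨ε, hε, hball⟩ := h.exists_ball_forall_mem Q
  refine ⟨ε, hε, ?_⟩
  have hbdry : ∀ y ∈ Metric.ball Q ε, y ∈ ⋃₀ S → ⟪n, y - Q⟫ = 0 := by
    rintro y hy ⟨t, ht, hyt⟩
    rw [hQs t ht (hball t ht ⟨y, hyt, hy⟩)] at hyt
    exact hns y hyt
  have hmap : IsLinearMap ℝ fun y : Plane => ⟪n, y⟫ :=
    ⟨fun x y => inner_add_right n x y, fun c x => inner_smul_right n x c⟩
  have hpos : {y ∈ Metric.ball Q ε | ⟪n, Q⟫ < ⟪n, y⟫} ⊆ G ∨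
      {y ∈ Metric.ball Q ε | ⟪n, Q⟫ < ⟪n, y⟫} ⊆ H := by
    refine h.subset_or_subset ((convex_ball Q ε).inter (convex_halfSpace_gt hmap _))
      (Set.disjoint_left.mpr fun y hy hyS => ?_)
    have h1 := hbdry y hy.1 hyS
    rw [inner_sub_right] at h1
    linarith [hy.2]
  have hneg : {y ∈ Metric.ball Q ε | ⟪n, y⟫ < ⟪n, Q⟫} ⊆ G ∨
      {y ∈ Metric.ball Q ε | ⟪n, y⟫ < ⟪n, Q⟫} ⊆ H := by
    refine h.subset_or_subset ((convex_ball Q ε).inter (convex_halfSpace_lt hmap _))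
      (Set.disjoint_left.mpr fun y hy hyS => ?_)
    have h1 := hbdry y hy.1 hyS
    rw [inner_sub_right] at h1
    linarith [hy.2]
  have key : ∀ {G H : Set Plane}, SeparatedColoring G H S →
      {y ∈ Metric.ball Q ε | ⟪n, Q⟫ < ⟪n, y⟫} ⊆ G →
      {y ∈ Metric.ball Q ε | ⟪n, y⟫ < ⟪n, Q⟫} ⊆ G → False := by
    intro G H h h1 h2
    obtain ⟨y, hyb, hyH⟩ := mem_closure_iff_nhds.mp (h.sub_closure_right ⟨s, hs, hQ⟩)
      (Metric.ball Q ε) (Metric.ball_mem_nhds Q hε)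
    have hcurve : Filter.Tendsto (fun τ : ℝ => y + τ • n) (nhdsWithin 0 (Set.Ioi 0))
        (nhds y) := by
      have hc : Continuous fun τ : ℝ => y + τ • n := by fun_prop
      simpa using (hc.tendsto 0).mono_left nhdsWithin_le_nhds
    have hyn : ⟪n, y⟫ = ⟪n, Q⟫ := by
      rcases lt_trichotomy ⟪n, y⟫ ⟪n, Q⟫ with hlt | heq | hgt
      · exact (Set.disjoint_left.mp h.disjoint (h2 ⟨hyb, hlt⟩) hyH).elim
      · exact heq
      · exact (Set.disjoint_left.mp h.disjoint (h1 ⟨hyb, hgt⟩) hyH).elim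
    obtain ⟨τ, ⟨hτb, hτH⟩, hτ⟩ := ((hcurve.eventually (Filter.inter_mem
      (Metric.isOpen_ball.mem_nhds hyb) (h.isOpen_right.mem_nhds hyH))).and
        self_mem_nhdsWithin).exists
    refine Set.disjoint_left.mp h.disjoint (h1 ⟨hτb, ?_⟩) hτH
    rw [inner_add_right, inner_smul_right, hyn, real_inner_self_eq_norm_sq]
    have : 0 < τ := hτ
    have : 0 < ‖n‖ := norm_pos_iff.mpr hn
    linarith [show 0 < τ * ‖n‖ ^ 2 by positivity]
  simp only [inner_sub_right, sub_pos, sub_neg]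
  rcases hpos with hp | hp <;> rcases hneg with hm | hm
  · exact (key h hp hm).elim
  · exact Or.inl ⟨fun y hy hlt => hp ⟨hy, hlt⟩, fun y hy hlt => hm ⟨hy, hlt⟩⟩
  · exact Or.inr ⟨fun y hy hlt => hp ⟨hy, hlt⟩, fun y hy hlt => hm ⟨hy, hlt⟩⟩
  · exact (key h.symm hp hm).elim

/-- A circle crossing a single boundary segment transversally changes colour there. -/
theorem mem_changes_of_crossing (h : SeparatedColoring G H S) {s : Set Plane} (hs : s ∈ S)
    {A u : Plane} (hu : ‖u‖ = 1) (hQ : A + u ∈ s) (hQs : ∀ t ∈ S, A + u ∈ t → t = s)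
    {n : Plane} (hns : ∀ x ∈ s, ⟪n, x - (A + u)⟫ = 0)
    (hcross : ⟪n, quarterTurn u⟫ ≠ 0) : u ∈ changes G H A := by
  have hn : n ≠ 0 := by
    rintro rfl
    simp at hcross
  obtain ⟨ε, hε, hdisk⟩ := h.exists_half_disks hs hQ hQs hn hns
  have key : ∀ {C : Set Plane} {m : Plane}, ⟪m, quarterTurn u⟫ ≠ 0 →
      (∀ y ∈ Metric.ball (A + u) ε, 0 < ⟪m, y - (A + u)⟫ → y ∈ C) →
      u ∈ closure (unitArc C A) := by
    intro C m hm hC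
    rw [mem_closure_iff_frequently]
    refine (tendsto_turn u).frequently (((frequently_inner_lt_inner_turn hm).and_eventually
      ((tendsto_turn u) (Metric.ball_mem_nhds u hε))).mono ?_)
    rintro τ ⟨hτ, hτb⟩
    refine ⟨norm_turn hu τ, hC _ ?_ ?_⟩
    · simpa using hτb
    · rw [add_sub_add_left_eq_sub, inner_sub_right]
      linarith
  have hneg : ⟪-n, quarterTurn u⟫ ≠ 0 := by simpa [inner_neg_left] using hcross
  rcases hdisk with ⟨h1, h2⟩ | ⟨h1, h2⟩
  · exact ⟨key hcross h1, key hneg fun y hy hlt => h2 y hy (by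
      rw [inner_neg_left] at hlt; linarith)⟩
  · exact ⟨key hneg fun y hy hlt => h2 y hy (by
      rw [inner_neg_left] at hlt; linarith), key hcross h1⟩

/-- A circle tangent to a single boundary segment does not change colour there. -/
theorem notMem_changes_of_tangent (h : SeparatedColoring G H S) {s : Set Plane} (hs : s ∈ S)
    {A u : Plane} (hu : ‖u‖ = 1) (hQ : A + u ∈ s) (hQs : ∀ t ∈ S, A + u ∈ t → t = s)
    (hus : ∀ x ∈ s, ⟪u, x - (A + u)⟫ = 0) : u ∉ changes G H A := by
  intro hch
  have hu0 : u ≠ 0 := by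
    rintro rfl
    simp at hu
  obtain ⟨ε, hε, hdisk⟩ := h.exists_half_disks hs hQ hQs hu0 hus
  have key : ∀ {G H : Set Plane}, SeparatedColoring G H S →
      (∀ y ∈ Metric.ball (A + u) ε, ⟪u, y - (A + u)⟫ < 0 → y ∈ G) →
      u ∉ closure (unitArc H A) := by
    intro G H h hG hc
    obtain ⟨v, hvb, hv1, hvH⟩ := mem_closure_iff_nhds.mp hc _ (Metric.ball_mem_nhds u hε)
    have hvu : v ≠ u := by
      rintro rfl
      exact (h.mem_sUnion_iff.mp ⟨s, hs, hQ⟩).2 hvH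
    refine Set.disjoint_left.mp h.disjoint (hG (A + v) (by simpa using hvb) ?_) hvH
    rw [add_sub_add_left_eq_sub, inner_sub_right, real_inner_self_eq_norm_sq, hu]
    have := (inner_lt_one_iff_real_of_norm_eq_one hu hv1).mpr hvu.symm
    linarith
  rcases hdisk with ⟨-, h2⟩ | ⟨-, h2⟩
  · exact key h.symm h2 hch.1
  · exact key h h2 hch.2

theorem finite_antipodal (h : SeparatedColoring G H S) {s t : Set Plane} (hs : s ∈ S)
    (ht : t ∈ S) (X : Plane) {r n : Plane} (hns : ∀ x ∈ s, ∀ y ∈ s, ⟪n, x - y⟫ = 0)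
    (hnr : ⟪n, r⟫ ≠ 0) :
    {δ : ℝ | ∃ u : Plane, ‖u‖ = 1 ∧ X + δ • r + u ∈ s ∧ X + δ • r + -u ∈ t}.Finite := by
  rcases s.eq_empty_or_nonempty with rfl | ⟨p, hp⟩
  · simp
  rcases t.eq_empty_or_nonempty with rfl | ⟨q, hq⟩
  · simp
  obtain ⟨m, hm, hmt⟩ := h.exists_normal t ht
  set w := ⟪m, r⟫ • n + ⟪n, r⟫ • m with hw
  have hw0 : w ≠ 0 := by
    intro h0
    have h1 : ⟪w, r⟫ = 0 := by rw [h0, inner_zero_left]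
    rw [hw, inner_add_left, real_inner_smul_left, real_inner_smul_left] at h1
    have h2 : ⟪m, r⟫ = 0 := by
      have : ⟪n, r⟫ * ⟪m, r⟫ = 0 := by linarith
      exact (mul_eq_zero.mp this).resolve_left hnr
    rw [h2, zero_smul, zero_add] at hw
    exact smul_ne_zero hnr hm (hw ▸ h0)
  refine ((finite_unit_inner_eq hw0 (⟪m, r⟫ * ⟪n, p - X⟫ - ⟪n, r⟫ * ⟪m, q - X⟫)).image
    fun u => (⟪n, p - X⟫ - ⟪n, u⟫) / ⟪n, r⟫).subset ?_
  rintro δ ⟨u, hu, hus, hut⟩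
  have h1 := hns _ hus _ hp
  have h2 := hmt _ hut _ hq
  simp only [inner_sub_right, inner_add_right, inner_neg_right, inner_smul_right] at h1 h2
  refine ⟨u, ⟨hu, ?_⟩, ?_⟩
  · rw [hw, inner_add_left, real_inner_smul_left, real_inner_smul_left, inner_sub_right,
      inner_sub_right]
    linear_combination ⟪m, r⟫ * h1 - ⟪n, r⟫ * h2
  · simp only [inner_sub_right]
    rw [div_eq_iff hnr]
    linarith

/-- When the centre moves along the boundary in direction `r`, all but finitely many of the
circles change colour only on segments parallel to `r`. -/
theorem eventually_parallel (h : SeparatedColoring G H S) {X r : Plane}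
    (hr : ∀ᶠ δ : ℝ in nhdsWithin 0 (Set.Ioi 0), X + δ • r ∈ ⋃₀ S) :
    ∀ᶠ δ : ℝ in nhdsWithin 0 (Set.Ioi 0), ∀ u ∈ changes G H (X + δ • r), ∀ s ∈ S,
      X + δ • r + u ∈ s → ∀ n : Plane, (∀ x ∈ s, ∀ y ∈ s, ⟪n, x - y⟫ = 0) →
        ⟪n, r⟫ = 0 := by
  set T := {s ∈ S | (s ∩ Metric.closedBall X (‖r‖ + 1)).Nonempty} with hT
  have hTfin : T.Finite := h.loc_finite _ Metric.isBounded_closedBall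
  set T' := {s ∈ T | ∃ n : Plane, (∀ x ∈ s, ∀ y ∈ s, ⟪n, x - y⟫ = 0) ∧ ⟪n, r⟫ ≠ 0} with hT'
  set K := ⋃ s ∈ T', ⋃ t ∈ T,
    {δ : ℝ | ∃ u : Plane, ‖u‖ = 1 ∧ X + δ • r + u ∈ s ∧ X + δ • r + -u ∈ t} with hKdef
  have hK : K.Finite := by
    refine (hTfin.subset fun s hs => hs.1).biUnion fun s hs => hTfin.biUnion fun t ht => ?_
    obtain ⟨n, hns, hnr⟩ := hs.2
    exact h.finite_antipodal hs.1.1 ht.1 X hns hnr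
  have hK0 : (K \ {0})ᶜ ∈ nhds (0 : ℝ) :=
    (hK.subset Set.sdiff_subset).isClosed.isOpen_compl.mem_nhds (by simp)
  filter_upwards [hr, nhdsWithin_le_nhds hK0, self_mem_nhdsWithin,
    nhdsWithin_le_nhds (gt_mem_nhds one_pos)] with δ hδS hδK hδ0 hδ1 u hu s hs hus n hns
  by_contra hnr
  have hδ0' : 0 < δ := hδ0
  have hu1 : ‖u‖ = 1 := norm_of_mem_closure_unitArc hu.1
  obtain ⟨t, ht, hut⟩ := h.add_mem_of_mem_changes (h.neg_mem_changes hδS hu)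
  have hδr : ‖δ • r‖ ≤ ‖r‖ := by
    rw [norm_smul, Real.norm_of_nonneg hδ0'.le]
    exact mul_le_of_le_one_left (norm_nonneg r) hδ1.le
  have hball : ∀ v : Plane, ‖v‖ = 1 → X + δ • r + v ∈ Metric.closedBall X (‖r‖ + 1) := by
    intro v hv
    rw [mem_closedBall_iff_norm, add_assoc, add_sub_cancel_left]
    linarith [norm_add_le (δ • r) v]
  refine hδK ⟨?_, hδ0'.ne'⟩
  refine Set.mem_biUnion (show s ∈ T' from ⟨⟨hs, _, hus, hball u hu1⟩, n, hns, hnr⟩)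
    (Set.mem_biUnion (show t ∈ T from ⟨ht, _, hut, hball (-u) (by rwa [norm_neg])⟩)
      ⟨u, hu1, hus, hut⟩)

/-- A change on the circle around `X` is carried along when the centre leaves `X` along a
boundary direction `r`, and the boundary at the change has a segment in direction `r`. -/
theorem eventually_mem_changes (h : SeparatedColoring G H S) {X e r : Plane} (hr0 : r ≠ 0)
    (hr : ∀ᶠ δ : ℝ in nhdsWithin 0 (Set.Ioi 0), X + δ • r ∈ ⋃₀ S) (he : e ∈ changes G H X) :
    ∀ᶠ δ : ℝ in nhdsWithin 0 (Set.Ioi 0), e ∈ changes G H (X + δ • r) ∧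
      ∃ s ∈ S, X + e ∈ s ∧ X + e + δ • r ∈ s ∧ ∀ t ∈ S, X + e + δ • r ∈ t → t = s := by
  obtain ⟨ρ, hρ, hball⟩ := h.exists_ball_forall_mem (X + e)
  have hfin := finite_unit_inner_eq (quarterTurn_ne_zero hr0) ⟪quarterTurn r, e⟫
  have hU : Metric.ball e (ρ / 2) ∩
      ({u : Plane | ‖u‖ = 1 ∧ ⟪quarterTurn r, u⟫ = ⟪quarterTurn r, e⟫} \ {e})ᶜ ∈ nhds e :=
    Filter.inter_mem (Metric.ball_mem_nhds e (half_pos hρ))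
      ((hfin.subset Set.sdiff_subset).isClosed.isOpen_compl.mem_nhds (by simp))
  have hmove : Filter.Tendsto (fun δ : ℝ => X + δ • r) (nhdsWithin 0 (Set.Ioi 0)) (nhds X) := by
    have hc : Continuous fun δ : ℝ => X + δ • r := by fun_prop
    simpa using (hc.tendsto 0).mono_left nhdsWithin_le_nhds
  filter_upwards [h.eventually_parallel hr, hmove.eventually (h.eventually_exists_mem_changes he hU),
    hmove (Metric.ball_mem_nhds X (half_pos hρ)), self_mem_nhdsWithin]
    with δ hpar hch hδρ hδ0
  have hδ0' : 0 < δ := hδ0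
  obtain ⟨u, ⟨huρ, hue⟩, hu⟩ := hch
  obtain ⟨s, hs, hus⟩ := h.add_mem_of_mem_changes hu
  have hnear : ∀ v ∈ Metric.ball e (ρ / 2), X + δ • r + v ∈ Metric.ball (X + e) ρ := by
    intro v hv
    have hδρ' : dist (X + δ • r) X < ρ / 2 := hδρ
    have hv' : dist v e < ρ / 2 := hv
    exact Metric.mem_ball.mpr (by linarith [dist_add_add_le (X + δ • r) v X e])
  have hP : X + e ∈ s := hball s hs ⟨_, hus, hnear u huρ⟩
  obtain ⟨n, hn, hns⟩ := h.exists_normal s hs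
  have hnr := hpar u hu s hs hus n hns
  have hu_eq : u = e := by
    by_contra hne
    refine hue ⟨⟨norm_of_mem_closure_unitArc hu.1, ?_⟩, hne⟩
    have h1 := hns _ hus _ hP
    obtain ⟨c, hc⟩ := exists_eq_smul hr0 hn
      ((real_inner_comm _ _).trans (inner_quarterTurn_self r)) ((real_inner_comm _ _).trans hnr)
    simp only [inner_sub_right, inner_add_right, inner_smul_right, hnr] at h1
    rw [hc, real_inner_smul_left, real_inner_smul_left]
    congr 1
    linarith
  subst hu_eq
  have hcomm : X + δ • r + u = X + u + δ • r := by abel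
  refine ⟨hu, s, hs, hP, hcomm ▸ hus, fun t ht hut => ?_⟩
  by_contra hts
  have hPt : X + u ∈ t := hball t ht ⟨_, hut, hcomm ▸ hnear u huρ⟩
  have := h.inter_subsingleton t ht s hs hts ⟨hut, hcomm ▸ hus⟩ ⟨hPt, hP⟩
  simp [hδ0'.ne', hr0] at this

theorem inner_ne_zero_of_mem_changes (h : SeparatedColoring G H S) {X e r : Plane} (hr0 : r ≠ 0)
    (hr : ∀ᶠ δ : ℝ in nhdsWithin 0 (Set.Ioi 0), X + δ • r ∈ ⋃₀ S) (he : e ∈ changes G H X) :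
    ⟪e, r⟫ ≠ 0 := by
  intro her
  obtain ⟨δ, ⟨hch, s, hs, hP, hQ, hQs⟩, hδ⟩ :=
    ((h.eventually_mem_changes hr0 hr he).and self_mem_nhdsWithin).exists
  have hδ' : δ ≠ 0 := ne_of_gt hδ
  have hcomm : X + e + δ • r = X + δ • r + e := by abel
  rw [hcomm] at hQ hQs
  have he1 := norm_of_mem_closure_unitArc he.1
  refine h.notMem_changes_of_tangent hs he1 hQ hQs (fun x hx => ?_) hch
  obtain ⟨n, hn, hns⟩ := h.exists_normal s hs
  have h1 := hns _ hQ _ hP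
  have hnr : ⟪n, r⟫ = 0 := by
    simp only [inner_sub_right, inner_add_right, inner_smul_right] at h1
    have : δ * ⟪n, r⟫ = 0 := by linarith
    exact (mul_eq_zero.mp this).resolve_left hδ'
  obtain ⟨c, hc⟩ := exists_eq_smul hn hr0 (hns x hx _ hQ) hnr
  rw [hc, inner_smul_right, her, mul_zero]

/-- Two boundary directions on the same side of a change are parallel. -/
theorem exists_common_normal (h : SeparatedColoring G H S) {X e r₁ r₂ : Plane} (hr₂0 : r₂ ≠ 0)
    (hr₁ : ∀ᶠ δ : ℝ in nhdsWithin 0 (Set.Ioi 0), X + δ • r₁ ∈ ⋃₀ S)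
    (hr₂ : ∀ᶠ δ : ℝ in nhdsWithin 0 (Set.Ioi 0), X + δ • r₂ ∈ ⋃₀ S)
    (he : e ∈ changes G H X) (her₁ : 0 < ⟪e, r₁⟫) (her₂ : 0 < ⟪e, r₂⟫) :
    ∃ n : Plane, n ≠ 0 ∧ ⟪n, r₁⟫ = 0 ∧ ⟪n, r₂⟫ = 0 := by
  have he1 := norm_of_mem_closure_unitArc he.1
  obtain ⟨ρ, hρ, hball⟩ := h.exists_ball_forall_mem (X + e)
  have hsmall : ∀ᶠ δ : ℝ in nhdsWithin 0 (Set.Ioi 0), δ * ‖r₂‖ < ρ := by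
    have hc : Continuous fun δ : ℝ => δ * ‖r₂‖ := by fun_prop
    exact nhdsWithin_le_nhds ((hc.tendsto 0) (gt_mem_nhds (by simpa using hρ)))
  obtain ⟨η, ⟨⟨-, s, hs, hP, hQη, -⟩, hηρ⟩, hη⟩ :=
    (((h.eventually_mem_changes hr₂0 hr₂ he).and hsmall).and self_mem_nhdsWithin).exists
  have hη0 : 0 < η := hη
  obtain ⟨n, hn, hns⟩ := h.exists_normal s hs
  have hnr₂ : ⟪n, r₂⟫ = 0 := by
    have h1 := hns _ hQη _ hP
    simp only [inner_sub_right, inner_add_right, inner_smul_right] at h1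
    have : η * ⟪n, r₂⟫ = 0 := by linarith
    exact (mul_eq_zero.mp this).resolve_left hη0.ne'
  have hfar : ∀ᶠ δ : ℝ in nhdsWithin 0 (Set.Ioi 0), 1 < ‖e + η • r₂ - δ • r₁‖ := by
    have hc : Continuous fun δ : ℝ => ‖e + η • r₂ - δ • r₁‖ := by fun_prop
    refine nhdsWithin_le_nhds ((hc.tendsto 0) (lt_mem_nhds ?_))
    have hsq : ‖e + η • r₂‖ ^ 2 = 1 + 2 * (η * ⟪e, r₂⟫) + ‖η • r₂‖ ^ 2 := by
      rw [norm_add_sq_real, he1, inner_smul_right]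
      ring
    have : 0 < η * ⟪e, r₂⟫ := by positivity
    simp only [zero_smul, sub_zero]
    nlinarith [norm_nonneg (e + η • r₂), sq_nonneg ‖η • r₂‖]
  have hnear : ∀ᶠ δ : ℝ in nhdsWithin 0 (Set.Ioi 0), δ * ‖r₁‖ ^ 2 < 2 * ⟪e, r₁⟫ := by
    have hc : Continuous fun δ : ℝ => δ * ‖r₁‖ ^ 2 := by fun_prop
    exact nhdsWithin_le_nhds ((hc.tendsto 0) (gt_mem_nhds (by simpa using her₁)))
  have htransverse : ∀ᶠ δ : ℝ in nhdsWithin 0 (Set.Ioi 0), δ * ⟪r₁, r₂⟫ < ⟪e, r₂⟫ := by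
    have hc : Continuous fun δ : ℝ => δ * ⟪r₁, r₂⟫ := by fun_prop
    exact nhdsWithin_le_nhds ((hc.tendsto 0) (gt_mem_nhds (by simpa using her₂)))
  obtain ⟨δ, ⟨⟨⟨hpar, hδfar⟩, hδnear⟩, hδt⟩, hδ⟩ := ((((h.eventually_parallel hr₁).and hfar).and
    hnear).and htransverse |>.and self_mem_nhdsWithin).exists
  have hδ0 : 0 < δ := hδ
  have hlow : ‖e + (0 : ℝ) • r₂ - δ • r₁‖ < 1 := by
    have hsq : ‖e - δ • r₁‖ ^ 2 = 1 - 2 * (δ * ⟪e, r₁⟫) + δ ^ 2 * ‖r₁‖ ^ 2 := by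
      rw [norm_sub_sq_real, he1, inner_smul_right, norm_smul, Real.norm_of_nonneg hδ0.le]
      ring
    rw [zero_smul, add_zero]
    nlinarith [norm_nonneg (e - δ • r₁), mul_pos hδ0 (sub_pos.mpr hδnear)]
  obtain ⟨κ, ⟨hκ0, hκη⟩, hκ⟩ := intermediate_value_Icc hη0.le
    (f := fun κ : ℝ => ‖e + κ • r₂ - δ • r₁‖)
    (by fun_prop) ⟨hlow.le, hδfar.le⟩
  have hκpos : 0 < κ := by
    refine lt_of_le_of_ne hκ0 ?_
    rintro rfl
    exact hlow.ne hκ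
  set u := e + κ • r₂ - δ • r₁ with hu
  have hAu : X + δ • r₁ + u = X + e + κ • r₂ := by
    rw [hu]
    abel
  have hQ : X + δ • r₁ + u ∈ s := by
    rw [hAu]
    have hmem := h.convex s hs hP hQη (a := 1 - κ / η) (b := κ / η)
      (by rw [sub_nonneg]; exact (div_le_one hη0).mpr hκη) (by positivity) (by ring)
    have heq : (1 - κ / η) • (X + e) + (κ / η) • (X + e + η • r₂) = X + e + κ • r₂ := by
      rw [smul_add (κ / η), ← add_assoc, ← add_smul, smul_smul, div_mul_cancel₀ _ hη0.ne',
        sub_add_cancel, one_smul]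
    rwa [heq] at hmem
  have hQs : ∀ t ∈ S, X + δ • r₁ + u ∈ t → t = s := by
    intro t ht hut
    by_contra hts
    have hPt : X + e ∈ t := by
      refine hball t ht ⟨_, hut, ?_⟩
      rw [hAu, mem_ball_iff_norm, add_sub_cancel_left, norm_smul, Real.norm_of_nonneg hκ0]
      exact (mul_le_mul_of_nonneg_right hκη (norm_nonneg _)).trans_lt hηρ
    have := h.inter_subsingleton t ht s hs hts ⟨hut, hQ⟩ ⟨hPt, hP⟩
    rw [hAu] at this
    simp [hκpos.ne', hr₂0] at this
  have hur₂ : 0 < ⟪u, r₂⟫ := by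
    rw [hu, inner_sub_left, inner_add_left, real_inner_smul_left, real_inner_smul_left,
      real_inner_self_eq_norm_sq]
    have : 0 ≤ κ * ‖r₂‖ ^ 2 := by positivity
    linarith
  have hcross : ⟪n, quarterTurn u⟫ ≠ 0 := by
    intro h0
    have hu0 : u ≠ 0 := by
      intro hu0
      simp [hu0] at hur₂
    obtain ⟨c, hc⟩ := exists_eq_smul hn (quarterTurn_ne_zero hu0) hnr₂ h0
    rw [hc, inner_smul_right, real_inner_comm, inner_quarterTurn_self, mul_zero] at hur₂
    exact hur₂.false
  have hch := h.mem_changes_of_crossing hs hκ hQ hQs (fun x hx => hns x hx _ hQ) hcross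
  exact ⟨n, hn, hpar u hch s hs hQ n hns, hnr₂⟩

/-- Three boundary directions at a point are never pairwise independent. -/
theorem exists_common_normal_of_three (h : SeparatedColoring G H S) {X : Plane}
    (hX : X ∈ ⋃₀ S) {r : Fin 3 → Plane} (hr0 : ∀ i, r i ≠ 0)
    (hr : ∀ i, ∀ᶠ δ : ℝ in nhdsWithin 0 (Set.Ioi 0), X + δ • r i ∈ ⋃₀ S) :
    ∃ i j, i ≠ j ∧ ∃ n : Plane, n ≠ 0 ∧ ⟪n, r i⟫ = 0 ∧ ⟪n, r j⟫ = 0 := by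
  obtain ⟨e, he⟩ := h.nonempty_changes hX
  obtain ⟨i, j, hij, hsign⟩ := Fintype.exists_ne_map_eq_of_card_lt
    (fun i => decide (0 < ⟪e, r i⟫)) (by simp)
  refine ⟨i, j, hij, ?_⟩
  rw [decide_eq_decide] at hsign
  by_cases hi : 0 < ⟪e, r i⟫
  · exact h.exists_common_normal (hr0 j) (hr i) (hr j) he hi (hsign.mp hi)
  · have hpos : ∀ k, ¬0 < ⟪e, r k⟫ → 0 < ⟪-e, r k⟫ := by
      intro k hk
      rw [inner_neg_left, neg_pos]
      exact lt_of_le_of_ne (not_lt.mp hk) (h.inner_ne_zero_of_mem_changes (hr0 k) (hr k) he)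
    exact h.exists_common_normal (hr0 j) (hr i) (hr j) (h.neg_mem_changes hX he) (hpos i hi)
      (hpos j (fun hj => hi (hsign.mpr hj)))

end SeparatedColoring

theorem IsSeg.exists_normal {s : Set Plane} (hs : IsSeg s) :
    ∃ n : Plane, n ≠ 0 ∧ ∀ x ∈ s, ∀ y ∈ s, ⟪n, x - y⟫ = 0 := by
  obtain ⟨-, -, -, l, ⟨-, hl⟩, hsl⟩ := hs
  obtain ⟨d, hd, hdl⟩ := finrank_eq_one_iff'.mp hl
  have hd0 : (d : Plane) ≠ 0 := by simpa using hd
  refine ⟨quarterTurn d, quarterTurn_ne_zero hd0, fun x hx y hy => ?_⟩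
  obtain ⟨c, hc⟩ := hdl ⟨x - y, AffineSubspace.vsub_mem_direction (hsl hx) (hsl hy)⟩
  have hc' : c • (d : Plane) = x - y := congrArg Subtype.val hc
  rw [← hc', inner_smul_right, inner_quarterTurn_self, mul_zero]

theorem IsPolygonal.separatedColoring {B : Set Plane} {S : Set (Set Plane)}
    (hpoly : IsPolygonal B S) (hC3 : C3 B) :
    SeparatedColoring (interior B) (interior Bᶜ) S := by
  have hdisj : Disjoint (interior B) (interior Bᶜ) :=
    disjoint_compl_right.mono interior_subset interior_subset
  have hfront : (interior B ∪ interior Bᶜ)ᶜ = frontier B := by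
    rw [interior_compl, Set.compl_union, compl_compl, Set.inter_comm]
    rfl
  have htri : ∀ A u : Plane, ‖u‖ = 1 →
      dist A (A + u) = 1 ∧ dist (A + u) (A + sixthTurn u) = 1 ∧ dist (A + sixthTurn u) A = 1 := by
    intro A u hu
    refine ⟨by simpa using hu, ?_, by simpa using norm_sixthTurn hu⟩
    rw [dist_add_left, dist_comm, dist_eq_norm]
    exact norm_sixthTurn_sub hu
  have hnot : ∀ x ∈ interior B ∪ interior Bᶜ, x ∉ frontier B := fun x hx => by
    rw [← hfront]
    exact fun hc => hc hx
  refine ⟨isOpen_interior, isOpen_interior, hdisj, hfront.trans hpoly.boundary, ?_, ?_,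
    fun s hs => (hpoly.seg s hs).1, fun s hs => (hpoly.seg s hs).2.1,
    fun s hs => (hpoly.seg s hs).exists_normal, hpoly.inter_subsingleton, hpoly.loc_finite, ?_, ?_⟩
  · rw [← hpoly.boundary]
    exact frontier_subset_closure.trans (closure_minimal hpoly.black_sub isClosed_closure)
  · rw [← hpoly.boundary, ← frontier_compl]
    exact frontier_subset_closure.trans (closure_minimal hpoly.white_sub isClosed_closure)
  · intro A u hu h1 h2 h3
    obtain ⟨d1, d2, d3⟩ := htri A u hu
    rcases hC3 _ _ _ d1 d2 d3
      (Or.inl ⟨interior_subset h1, interior_subset h2, interior_subset h3⟩) with hf | hf | hf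
    · exact hnot _ (Or.inl h1) hf
    · exact hnot _ (Or.inl h2) hf
    · exact hnot _ (Or.inl h3) hf
  · intro A u hu h1 h2 h3
    obtain ⟨d1, d2, d3⟩ := htri A u hu
    rcases hC3 _ _ _ d1 d2 d3
      (Or.inr ⟨interior_subset h1, interior_subset h2, interior_subset h3⟩) with hf | hf | hf
    · exact hnot _ (Or.inr h1) hf
    · exact hnot _ (Or.inr h2) hf
    · exact hnot _ (Or.inr h3) hf

/-- At every point of a boundary segment, the boundary leaves along the segment. -/
theorem IsPolygonal.exists_direction {B : Set Plane} {S : Set (Set Plane)}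
    (hpoly : IsPolygonal B S) {s : Set Plane} (hs : s ∈ S) {x : Plane} (hx : x ∈ s) :
    ∃ r : Plane, r ≠ 0 ∧ x + r ∈ s ∧
      ∀ᶠ δ : ℝ in nhdsWithin 0 (Set.Ioi 0), x + δ • r ∈ ⋃₀ S := by
  obtain ⟨y, hy, hyx⟩ := (hpoly.seg s hs).2.2.1.exists_ne x
  refine ⟨y - x, sub_ne_zero.mpr hyx, by simpa using hy, ?_⟩
  filter_upwards [self_mem_nhdsWithin, nhdsWithin_le_nhds (gt_mem_nhds one_pos)] with δ hδ0 hδ1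
  exact ⟨s, hs, (hpoly.seg s hs).2.1.add_smul_sub_mem hx hy ⟨le_of_lt hδ0, hδ1.le⟩⟩

theorem IsPolygonal.not_common_normal {B : Set Plane} {S : Set (Set Plane)}
    (hpoly : IsPolygonal B S) {s t : Set Plane} (hs : s ∈ S) (ht : t ∈ S) (hst : s ≠ t)
    {x r q n : Plane} (hxs : x ∈ s) (hxt : x ∈ t) (hr0 : r ≠ 0) (hq0 : q ≠ 0)
    (hr : x + r ∈ s) (hq : x + q ∈ t) (hn : n ≠ 0) (hnr : ⟪n, r⟫ = 0) (hnq : ⟪n, q⟫ = 0) :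
    False := by
  have hsub : ∀ {a : Set Plane} {p : Plane}, a ∈ S → x ∈ a → p ≠ 0 → x + p ∈ a →
      ⟪n, p⟫ = 0 → a ⊆ (AffineSubspace.mk' x (Submodule.span ℝ {r}) : Set Plane) := by
    intro a p ha hxa hp0 hpa hnp y hy
    obtain ⟨m, hm, hma⟩ := (hpoly.seg a ha).exists_normal
    have hmp : ⟪m, p⟫ = 0 := by simpa using hma _ hpa _ hxa
    obtain ⟨c, hc⟩ := exists_eq_smul hm hp0 (hma _ hy _ hxa) hmp
    obtain ⟨c', hc'⟩ := exists_eq_smul hn hr0 hnp hnr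
    rw [SetLike.mem_coe, AffineSubspace.mem_mk', vsub_eq_sub, Submodule.mem_span_singleton]
    exact ⟨c * c', by rw [hc, hc', smul_smul]⟩
  refine hpoly.no_common_line s hs t ht hst ⟨x, hxs, hxt⟩
    ⟨AffineSubspace.mk' x (Submodule.span ℝ {r}), ⟨⟨x, AffineSubspace.self_mem_mk' _ _⟩, ?_⟩,
      hsub hs hxs hr0 hr hnr, hsub ht hxt hq0 hq hnq⟩
  rw [AffineSubspace.direction_mk']
  exact finrank_span_singleton hr0

theorem stmt18 (B : Set (EuclideanSpace ℝ (Fin 2))) (S : Set (Set (EuclideanSpace ℝ (Fin 2))))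
    (hpoly : IsPolygonal B S) (hC3 : C3 B) :
    ¬∃ (x : EuclideanSpace ℝ (Fin 2)) (s₁ s₂ s₃ : Set (EuclideanSpace ℝ (Fin 2))),
      s₁ ∈ S ∧ s₂ ∈ S ∧ s₃ ∈ S ∧ s₁ ≠ s₂ ∧ s₁ ≠ s₃ ∧ s₂ ≠ s₃ ∧
      IsEndpoint x s₁ ∧ IsEndpoint x s₂ ∧ IsEndpoint x s₃ := by
  rintro ⟨x, s₁, s₂, s₃, hs₁, hs₂, hs₃, h12, h13, h23, hx₁, hx₂, hx₃⟩
  have hcol := hpoly.separatedColoring hC3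
  set s : Fin 3 → Set Plane := ![s₁, s₂, s₃] with hsdef
  have hs : ∀ i, s i ∈ S := by
    intro i
    fin_cases i <;> assumption
  have hx : ∀ i, x ∈ s i := by
    intro i
    fin_cases i
    exacts [hx₁.1, hx₂.1, hx₃.1]
  have hne : ∀ i j, i ≠ j → s i ≠ s j := by
    intro i j hij
    fin_cases i <;> fin_cases j <;> simp_all [Ne.symm]
  choose r hr0 hrs hr using fun i => hpoly.exists_direction (hs i) (hx i)
  obtain ⟨i, j, hij, n, hn, hni, hnj⟩ :=
    hcol.exists_common_normal_of_three ⟨s₁, hs₁, hx₁.1⟩ hr0 hr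
  exact hpoly.not_common_normal (hs i) (hs j) (hne i j hij) (hx i) (hx j) (hr0 i) (hr0 j)
    (hrs i) (hrs j) hn hni hnj

end
end
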